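/- Let q > 1 and suppose either p ∈ [q+1, 2q+1) ∩ [2q−2, 4q−2] or p = q+1, and let L > 0. If γ ∈ W^{1,1}_{i,r}(𝕋, ℝ^n) with L(γ) = L satisfies TP^{(p,q)}(γ) = L^{q+2−p} · π^{p−q} · ∫₀¹ sin(πw)^{2q−p} dw, then the image of γ is a round circle. -/

import Mathlib

open MeasureTheory Real Set intervalIntegral
open scoped ENNReal RealInnerProductSpace

noncomputable section

/-- A closed `W^{1,1}`-curve on the torus `𝕋 = ℝ/ℤ` with values in `ℝⁿ`, encoded as a
`1`-periodic absolutely continuous function `toFun : ℝ → ℝⁿ` together with its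
(weak) derivative `deriv'`. -/
structure ClosedCurve (n : ℕ) where
  toFun : ℝ → EuclideanSpace ℝ (Fin n)
  deriv' : ℝ → EuclideanSpace ℝ (Fin n)
  periodic : Function.Periodic toFun 1
  deriv'_periodic : Function.Periodic deriv' 1
  integrableOn : MeasureTheory.IntegrableOn deriv' (Set.Icc (0:ℝ) 1)
  eq_integral : ∀ t : ℝ, toFun t = toFun 0 + ∫ s in (0:ℝ)..t, deriv' s

namespace ClosedCurve

variable {n : ℕ}

/-- Injectivity as a map on the torus `ℝ/ℤ`. -/
def IsInj (γ : ClosedCurve n) : Prop :=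
  ∀ s t : ℝ, γ.toFun s = γ.toFun t → ∃ k : ℤ, s - t = (k : ℝ)

/-- Regularity: the derivative does not vanish a.e. -/
def IsRegular (γ : ClosedCurve n) : Prop := ∀ᵐ t : ℝ ∂volume, γ.deriv' t ≠ 0

/-- Parametrization by arc length: `|γ'| = 1` a.e. -/
def IsArclength (γ : ClosedCurve n) : Prop := ∀ᵐ t : ℝ ∂volume, ‖γ.deriv' t‖ = 1

/-- The length of a closed curve. -/
def length (γ : ClosedCurve n) : ℝ := ∫ t in (0:ℝ)..1, ‖γ.deriv' t‖

end ClosedCurve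

/-- Orthogonal projection onto the orthogonal complement of `span {v}` (for `v ≠ 0`). -/
def projPerp {F : Type*} [NormedAddCommGroup F] [InnerProductSpace ℝ F] (v x : F) : F :=
  x - (⟪v, x⟫ / ‖v‖ ^ 2) • v

/-- The Gauss map `φ_γ(u,w)`: the unit secant direction. -/
def gaussMap {n : ℕ} (γ : ClosedCurve n) (u w : ℝ) : EuclideanSpace ℝ (Fin n) :=
  ‖γ.toFun (u + w) - γ.toFun u‖⁻¹ • (γ.toFun (u + w) - γ.toFun u)

/-- `|∂_u φ_γ(u,w)|`, expressed via the identity (1.8) of the paper. -/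
def gaussDerivU {n : ℕ} (γ : ClosedCurve n) (u w : ℝ) : ℝ :=
  ‖projPerp (gaussMap γ u w) (γ.deriv' (u + w) - γ.deriv' u)‖ /
    ‖γ.toFun (u + w) - γ.toFun u‖

/-- `|∂_w φ_γ(u,w)|`, expressed via the identity (1.7) of the paper. -/
def gaussDerivW {n : ℕ} (γ : ClosedCurve n) (u w : ℝ) : ℝ :=
  ‖projPerp (gaussMap γ u w) (γ.deriv' (u + w))‖ / ‖γ.toFun (u + w) - γ.toFun u‖

/-- The generalized tangent-point energy `TP^{(p,q)}` (with values in `[0,∞]`). -/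
def TP {n : ℕ} (p q : ℝ) (γ : ClosedCurve n) : ℝ≥0∞ :=
  ∫⁻ u in Set.Ioc (0:ℝ) 1, ∫⁻ w in Set.Ioc (0:ℝ) 1,
    ENNReal.ofReal
      (‖projPerp (γ.deriv' u) (γ.toFun (u + w) - γ.toFun u)‖ ^ q /
        ‖γ.toFun (u + w) - γ.toFun u‖ ^ p * (‖γ.deriv' u‖ * ‖γ.deriv' (u + w)‖))

/-- The minorant `G^{(p,q)}_w`. -/
def Gw {n : ℕ} (p q : ℝ) (γ : ClosedCurve n) (w : ℝ) : ℝ≥0∞ :=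
  ∫⁻ u in Set.Ioc (0:ℝ) 1,
    ENNReal.ofReal ((1/2 * gaussDerivU γ u w) ^ q *
      ‖γ.toFun (u + w) - γ.toFun u‖ ^ (2*q - p))

/-- The minorant `G^{(p,q)}`. -/
def G {n : ℕ} (p q : ℝ) (γ : ClosedCurve n) : ℝ≥0∞ :=
  ∫⁻ w in Set.Ioc (0:ℝ) 1, Gw p q γ w

/-- A round circle in a euclidean space: a sphere intersected with a 2-dimensional plane
through its center. -/
def IsCircle {F : Type*} [NormedAddCommGroup F] [InnerProductSpace ℝ F] (S : Set F) : Prop :=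
  ∃ (c : F) (r : ℝ) (V : Submodule ℝ F), 0 < r ∧ Module.finrank ℝ V = 2 ∧
    S = {x | ‖x - c‖ = r ∧ x - c ∈ V}

/-- A great circle of the unit sphere. -/
def IsGreatCircle {F : Type*} [NormedAddCommGroup F] [InnerProductSpace ℝ F]
    (S : Set F) : Prop :=
  ∃ V : Submodule ℝ F, Module.finrank ℝ V = 2 ∧ S = {x | ‖x‖ = 1 ∧ x ∈ V}

/-- Half of a great circle of the unit sphere: a great-circle arc of angular length `π`. -/
def IsHalfGreatCircle {F : Type*} [NormedAddCommGroup F] [InnerProductSpace ℝ F]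
    (S : Set F) : Prop :=
  ∃ a b : F, ‖a‖ = 1 ∧ ‖b‖ = 1 ∧ ⟪a, b⟫ = 0 ∧
    S = (fun t : ℝ => Real.cos t • a + Real.sin t • b) '' Set.Icc 0 π

/-- A curve is convex if its image is the boundary (within its affine hull) of a convex
planar (2-dimensional) set. -/
def ClosedCurve.IsConvex {n : ℕ} (γ : ClosedCurve n) : Prop :=
  ∃ K : Set (EuclideanSpace ℝ (Fin n)), Convex ℝ K ∧
    Module.finrank ℝ (affineSpan ℝ K).direction = 2 ∧
    Set.range γ.toFun = intrinsicFrontier ℝ K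

section AngleLemmas

open InnerProductGeometry

variable {E : Type*} [NormedAddCommGroup E] [InnerProductSpace ℝ E]

lemma norm_projPerp {v : E} (hv : v ≠ 0) (x : E) :
    ‖projPerp v x‖ = Real.sin (angle v x) * ‖x‖ := by
  have hv' : 0 < ‖v‖ := norm_pos_iff.2 hv
  have h1 : (‖projPerp v x‖ * ‖v‖) ^ 2 = (Real.sin (angle v x) * ‖x‖ * ‖v‖) ^ 2 := by
    have h2 : (Real.sin (angle v x) * ‖x‖ * ‖v‖) ^ 2 =
        ‖v‖ ^ 2 * ‖x‖ ^ 2 - (Real.cos (angle v x) * (‖v‖ * ‖x‖)) ^ 2 := by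
      rw [mul_pow, mul_pow, Real.sin_sq]; ring
    rw [h2, cos_angle_mul_norm_mul_norm, mul_pow, projPerp, norm_sub_sq_real, norm_smul,
      real_inner_smul_right, real_inner_comm v x, mul_pow, Real.norm_eq_abs, sq_abs]
    field_simp
    ring
  have h3 := (sq_eq_sq₀ (by positivity)
    (by have := sin_angle_nonneg v x; positivity)).1 h1
  exact mul_right_cancel₀ hv'.ne' h3

lemma norm_projPerp_sub_le {d : E} (hd : d ≠ 0) (x y : E) :
    ‖projPerp d (x - y)‖ ≤ Real.sin (angle d x) * ‖x‖ + Real.sin (angle d y) * ‖y‖ := by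
  rw [← norm_projPerp hd, ← norm_projPerp hd]
  have : projPerp d (x - y) = projPerp d x - projPerp d y := by
    simp only [projPerp, inner_sub_right, sub_div, sub_smul]; abel
  rw [this]
  exact norm_sub_le _ _

lemma angle_le_norm_sub {x y : E} (hx : ‖x‖ = 1) (hy : ‖y‖ = 1) :
    angle x y ≤ π / 2 * ‖x - y‖ := by
  have h0 := angle_nonneg x y
  have hpi := angle_le_pi x y
  have h1 : ‖x - y‖ ^ 2 = (2 * Real.sin (angle x y / 2)) ^ 2 := by
    rw [norm_sub_sq_real, hx, hy, ← cos_angle_mul_norm_mul_norm, hx, hy, mul_pow,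
      Real.sin_sq_eq_half_sub]
    ring_nf
  have hs : 0 ≤ Real.sin (angle x y / 2) :=
    Real.sin_nonneg_of_nonneg_of_le_pi (by linarith) (by linarith)
  have h2 : ‖x - y‖ = 2 * Real.sin (angle x y / 2) :=
    (sq_eq_sq₀ (norm_nonneg _) (by positivity)).1 h1
  have h3 := Real.mul_le_sin (x := angle x y / 2) (by linarith) (by linarith)
  rw [h2]
  have : angle x y = π * (2 / π * (angle x y / 2)) := by field_simp
  calc angle x y = π * (2 / π * (angle x y / 2)) := this
    _ ≤ π * Real.sin (angle x y / 2) := by gcongr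
    _ = _ := by ring

lemma angle_le_norm_sub_div {x y : E} (hx : x ≠ 0) (hy : y ≠ 0) :
    angle x y ≤ π * ‖x - y‖ / ‖x‖ := by
  have hx' : 0 < ‖x‖ := norm_pos_iff.2 hx
  have hy' : 0 < ‖y‖ := norm_pos_iff.2 hy
  have h1 : angle x y = angle (‖x‖⁻¹ • x) (‖y‖⁻¹ • y) := by
    rw [angle_smul_left_of_pos _ _ (by positivity), angle_smul_right_of_pos _ _ (by positivity)]
  have nx : ‖‖x‖⁻¹ • x‖ = 1 := by rw [norm_smul, norm_inv, norm_norm]; field_simp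
  have ny : ‖‖y‖⁻¹ • y‖ = 1 := by rw [norm_smul, norm_inv, norm_norm]; field_simp
  rw [h1]
  refine (angle_le_norm_sub nx ny).trans ?_
  have h2 : ‖x‖⁻¹ • x - ‖y‖⁻¹ • y = ‖x‖⁻¹ • ((x - y) + ((‖y‖ - ‖x‖) * ‖y‖⁻¹) • y) := by
    have : ‖x‖⁻¹ * ((‖y‖ - ‖x‖) * ‖y‖⁻¹) = ‖x‖⁻¹ - ‖y‖⁻¹ := by field_simp
    rw [smul_add, smul_smul, this, smul_sub, sub_smul]; abel
  have h3 : ‖(x - y) + ((‖y‖ - ‖x‖) * ‖y‖⁻¹) • y‖ ≤ 2 * ‖x - y‖ := by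
    refine (norm_add_le _ _).trans ?_
    have : ‖((‖y‖ - ‖x‖) * ‖y‖⁻¹) • y‖ = |‖x‖ - ‖y‖| := by
      rw [norm_smul, norm_mul, norm_inv, norm_norm, mul_assoc, inv_mul_cancel₀ hy'.ne', mul_one,
        Real.norm_eq_abs, abs_sub_comm]
    rw [this]
    linarith [abs_norm_sub_norm_le x y]
  rw [h2, norm_smul, norm_inv, norm_norm]
  calc π / 2 * (‖x‖⁻¹ * ‖_‖) ≤ π / 2 * (‖x‖⁻¹ * (2 * ‖x - y‖)) := by gcongr
    _ = _ := by field_simp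

/-- The derivative of the angle between a fixed vector and a moving vector. -/
lemma deriv_angle_bounds {e : E} (he : ‖e‖ = 1) {D : ℝ → E} {D' : E} {t f' : ℝ}
    (hD : HasDerivAt D D' t) (h0 : D t ≠ 0)
    (hf : HasDerivAt (fun s => angle e (D s)) f' t) :
    |f'| ≤ ‖projPerp (D t) D'‖ / ‖D t‖ ∧
      Real.sin (angle e (D t)) * f' = -⟪e, projPerp (D t) D'⟫ / ‖D t‖ := by
  have hn : 0 < ‖D t‖ := norm_pos_iff.2 h0
  have hcos := hf.cos
  have hnorm : HasDerivAt (fun s => ‖D s‖) (⟪D t, D'⟫ / ‖D t‖) t := by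
    have h1 := (hD.norm_sq).sqrt (by positivity)
    simp only [Real.sqrt_sq (norm_nonneg _)] at h1
    convert h1 using 1
    field_simp
  have hinner : HasDerivAt (fun s => ⟪e, D s⟫) ⟪e, D'⟫ t := by
    simpa using (hasDerivAt_const t e).inner ℝ hD
  have hq := hinner.div hnorm hn.ne'
  have heq : (fun s => Real.cos (angle e (D s))) = (fun s => ⟪e, D s⟫) / fun s => ‖D s‖ := by
    ext s; rw [Pi.div_apply, cos_angle, he, one_mul]
  rw [heq] at hcos
  have hder := hcos.unique hq
  have hval : Real.sin (angle e (D t)) * f' = -⟪e, projPerp (D t) D'⟫ / ‖D t‖ := by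
    have : Real.sin (angle e (D t)) * f' = -(-Real.sin (angle e (D t)) * f') := by ring
    rw [this, hder, projPerp, inner_sub_right, real_inner_smul_right]
    field_simp
  refine ⟨?_, hval⟩
  rcases eq_or_ne (Real.sin (angle e (D t))) 0 with hs | hs
  · have : f' = 0 := by
      rcases sin_eq_zero_iff_angle_eq_zero_or_angle_eq_pi.1 hs with h | h
      · refine IsLocalMin.hasDerivAt_eq_zero (f := fun s => angle e (D s)) ?_ hf
        exact Filter.Eventually.of_forall fun s => by simpa [h] using angle_nonneg e (D s)
      · refine IsLocalMax.hasDerivAt_eq_zero (f := fun s => angle e (D s)) ?_ hf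
        exact Filter.Eventually.of_forall fun s => by simpa [h] using angle_le_pi e (D s)
    rw [this, abs_zero]; positivity
  · have hs' : 0 < Real.sin (angle e (D t)) := lt_of_le_of_ne (sin_angle_nonneg _ _) hs.symm
    have hP : ⟪e, projPerp (D t) D'⟫ = ⟪projPerp (D t) e, projPerp (D t) D'⟫ := by
      conv_rhs => rw [projPerp, inner_sub_left, real_inner_smul_left]
      have : ⟪D t, projPerp (D t) D'⟫ = 0 := by
        rw [projPerp, inner_sub_right, real_inner_smul_right, real_inner_self_eq_norm_sq]
        field_simp; ring
      rw [this]; ring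
    have hle : |⟪e, projPerp (D t) D'⟫| ≤ Real.sin (angle e (D t)) * ‖projPerp (D t) D'‖ := by
      rw [hP]
      refine (abs_real_inner_le_norm _ _).trans_eq ?_
      rw [norm_projPerp h0, he, mul_one, angle_comm]
    have h4 : Real.sin (angle e (D t)) * |f'| =  |⟪e, projPerp (D t) D'⟫| / ‖D t‖ := by
      rw [← abs_of_pos hs', ← abs_mul, hval, abs_div, abs_neg, abs_norm]
    have h5 : Real.sin (angle e (D t)) * |f'| ≤
        Real.sin (angle e (D t)) * (‖projPerp (D t) D'‖ / ‖D t‖) := by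
      rw [h4, ← mul_div_assoc]; gcongr
    exact le_of_mul_le_mul_left h5 hs'

lemma lipschitzOn_angle {e : E} {D : ℝ → E} {K : NNReal} (hD : LipschitzWith K D)
    {s : Set ℝ} {m : ℝ} (hm : 0 < m) (hs : ∀ t ∈ s, m ≤ ‖D t‖) :
    LipschitzOnWith (Real.toNNReal (π * K / m)) (fun t => angle e (D t)) s := by
  refine LipschitzOnWith.of_dist_le_mul fun x hx y hy => ?_
  rw [Real.coe_toNNReal _ (by positivity)]
  have key : ∀ x ∈ s, ∀ y ∈ s, angle e (D x) - angle e (D y) ≤ π * K / m * dist x y := by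
    intro x hx y hy
    have hx0 : D x ≠ 0 := norm_pos_iff.1 (hm.trans_le (hs x hx))
    have hy0 : D y ≠ 0 := norm_pos_iff.1 (hm.trans_le (hs y hy))
    have h1 := angle_le_angle_add_angle e (D y) (D x)
    have h2 := angle_le_norm_sub_div hy0 hx0
    have h3 : ‖D y - D x‖ ≤ K * dist x y := by
      rw [← dist_eq_norm, dist_comm x y]; exact hD.dist_le_mul _ _
    calc angle e (D x) - angle e (D y) ≤ π * ‖D y - D x‖ / ‖D y‖ := by linarith
      _ ≤ π * (K * dist x y) / m := by gcongr; exact hs y hy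
      _ = _ := by ring
  rw [Real.dist_eq, abs_le]
  constructor
  · have := key y hy x hx; rw [dist_comm] at this; linarith
  · exact key x hx y hy

end AngleLemmas

section AngleSweep

open InnerProductGeometry Filter Topology

variable {E : Type*} [NormedAddCommGroup E] [InnerProductSpace ℝ E]

lemma exists_lipschitzOn_angle_Icc {e : E} {D : ℝ → E} {K : NNReal} (hD : LipschitzWith K D)
    {a b : ℝ} (hab : a ≤ b) (h0 : ∀ t ∈ Icc a b, D t ≠ 0) :
    ∃ C : NNReal, LipschitzOnWith C (fun t => angle e (D t)) (Icc a b) := by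
  obtain ⟨t0, ht0, hmin⟩ := isCompact_Icc.exists_isMinOn (nonempty_Icc.2 hab)
    (hD.continuous.norm.continuousOn (s := Icc a b))
  exact ⟨_, lipschitzOn_angle hD (norm_pos_iff.2 (h0 t0 ht0)) fun t ht => hmin ht⟩

lemma ae_differentiableAt_angle {e : E} {D : ℝ → E} {K : NNReal} (hD : LipschitzWith K D)
    {a b : ℝ} (hab : a ≤ b) (h0 : ∀ t ∈ Icc a b, D t ≠ 0) :
    ∀ᵐ t, t ∈ Icc a b → DifferentiableAt ℝ (fun t => angle e (D t)) t := by
  obtain ⟨C, hC⟩ := exists_lipschitzOn_angle_Icc (e := e) hD hab h0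
  rw [← uIcc_of_le hab] at hC ⊢
  exact hC.absolutelyContinuousOnInterval.ae_differentiableAt

/-- The fundamental theorem of calculus for a function of the angle to a moving vector. -/
lemma integral_comp_angle_mul_deriv {e : E} {D : ℝ → E} {K : NNReal} (hD : LipschitzWith K D)
    {a b : ℝ} (hab : a ≤ b) (h0 : ∀ t ∈ Icc a b, D t ≠ 0) {h : ℝ → ℝ} (hh : Continuous h) :
    ∫ t in a..b, h (angle e (D t)) * deriv (fun t => angle e (D t)) t =
      ∫ z in angle e (D a)..angle e (D b), h z := by
  obtain ⟨C, hC⟩ := exists_lipschitzOn_angle_Icc (e := e) hD hab h0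
  have hF : ∀ x, HasDerivAt (fun z => ∫ y in (0:ℝ)..z, h y) (h x) x := fun x =>
    (hh.integral_hasStrictDerivAt 0 x).hasDerivAt
  obtain ⟨M, hM⟩ := isCompact_Icc.exists_bound_of_continuousOn (s := Icc 0 π) hh.continuousOn
  have hFlip : LipschitzOnWith M.toNNReal (fun z => ∫ y in (0:ℝ)..z, h y) (Icc 0 π) := by
    refine Convex.lipschitzOnWith_of_nnnorm_hasDerivWithin_le (convex_Icc 0 π)
      (fun x _ => (hF x).hasDerivWithinAt) fun x hx => ?_
    rw [← NNReal.coe_le_coe, coe_nnnorm]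
    exact (hM x hx).trans (Real.le_coe_toNNReal M)
  have hcomp := hFlip.comp hC fun t _ => ⟨angle_nonneg _ _, angle_le_pi _ _⟩
  have hdiff := ae_differentiableAt_angle (e := e) hD hab h0
  rw [← uIcc_of_le hab] at hcomp
  have hint := hcomp.absolutelyContinuousOnInterval.integral_deriv_eq_sub
  have hsub : ∫ z in angle e (D a)..angle e (D b), h z =
      (∫ y in (0:ℝ)..angle e (D b), h y) - ∫ y in (0:ℝ)..angle e (D a), h y :=
    (integral_interval_sub_left (hh.intervalIntegrable _ _) (hh.intervalIntegrable _ _)).symm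
  rw [hsub]
  refine Eq.trans ?_ hint
  refine integral_congr_ae ?_
  filter_upwards [hdiff] with t ht htm
  rw [uIoc_of_le hab] at htm
  exact ((hF _).comp t (ht (Ioc_subset_Icc_self htm)).hasDerivAt).deriv.symm

lemma measurable_angle {α : Type*} [MeasurableSpace α] [MeasurableSpace E] [BorelSpace E]
    [SecondCountableTopology E] {f g : α → E} (hf : Measurable f) (hg : Measurable g) :
    Measurable fun x => angle (f x) (g x) := by
  unfold angle
  exact Real.continuous_arccos.measurable.comp
    ((hf.inner hg).div (hf.norm.mul hg.norm))

lemma tendsto_angle_right {e : E} (he : e ≠ 0) {D : ℝ → E} {a : ℝ} (h : HasDerivAt D e a)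
    (ha : D a = 0) : Tendsto (fun w => angle e (D w)) (𝓝[>] a) (𝓝 0) := by
  have h1 := (hasDerivAt_iff_tendsto_slope.1 h).mono_left (nhdsGT_le_nhdsNE a)
  have h2 : Tendsto (fun w => angle e (slope D a w)) (𝓝[>] a) (𝓝 (angle e e)) :=
    Tendsto.comp (f := fun w => (e, slope D a w)) (g := fun y : E × E => angle y.1 y.2)
      (continuousAt_angle (x := (e, e)) he he) (tendsto_const_nhds.prodMk_nhds h1)
  rw [angle_self he] at h2
  refine h2.congr' ?_
  filter_upwards [self_mem_nhdsWithin] with w hw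
  rw [slope_def_module, ha, sub_zero, angle_smul_right_of_pos _ _ (inv_pos.2 (sub_pos.2 hw))]

lemma tendsto_angle_left {e : E} (he : e ≠ 0) {D : ℝ → E} {a : ℝ} (h : HasDerivAt D e a)
    (ha : D a = 0) : Tendsto (fun w => angle e (D w)) (𝓝[<] a) (𝓝 π) := by
  have h1 := (hasDerivAt_iff_tendsto_slope.1 h).mono_left (nhdsLT_le_nhdsNE a)
  have h2 : Tendsto (fun w => angle (-e) (slope D a w)) (𝓝[<] a) (𝓝 (angle (-e) e)) :=
    Tendsto.comp (f := fun w => (-e, slope D a w)) (g := fun y : E × E => angle y.1 y.2)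
      (continuousAt_angle (x := (-e, e)) (neg_ne_zero.2 he) he)
      (tendsto_const_nhds.prodMk_nhds h1)
  rw [angle_neg_left, angle_self he, sub_zero] at h2
  refine h2.congr' ?_
  filter_upwards [self_mem_nhdsWithin] with w hw
  rw [slope_def_module, ha, sub_zero, angle_smul_right_of_neg _ _ (inv_lt_zero.2 (sub_neg.2 hw)),
    angle_neg_neg]

/-- The angle between the tangent at the base point of a closed arc and the secant sweeps from
`0` to `π`. -/
lemma angle_sweep [FiniteDimensional ℝ E] [MeasurableSpace E] [BorelSpace E]
    {e : E} (he : ‖e‖ = 1) {D : ℝ → E} {K : NNReal} (hD : LipschitzWith K D)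
    (h0 : ∀ w ∈ Ioo (0:ℝ) 1, D w ≠ 0) (hl : HasDerivAt D e 0) (hD0 : D 0 = 0)
    (hr : HasDerivAt D e 1) (hD1 : D 1 = 0) {c : ℝ} (hc : 0 ≤ c)
    (hint : IntegrableOn (fun w => Real.sin (angle e (D w)) ^ c *
      (‖projPerp (D w) (deriv D w)‖ / ‖D w‖)) (Ioc 0 1)) :
    (∫ z in (0:ℝ)..π, Real.sin z ^ c) ≤ ∫ w in Ioc (0:ℝ) 1, Real.sin (angle e (D w)) ^ c *
        (‖projPerp (D w) (deriv D w)‖ / ‖D w‖) ∧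
    ((∫ z in (0:ℝ)..π, Real.sin z ^ c) = ∫ w in Ioc (0:ℝ) 1, Real.sin (angle e (D w)) ^ c *
        (‖projPerp (D w) (deriv D w)‖ / ‖D w‖) →
      ∀ᵐ w, w ∈ Ioo (0:ℝ) 1 → Real.sin (angle e (D w)) * ‖projPerp (D w) (deriv D w)‖ =
        -⟪e, projPerp (D w) (deriv D w)⟫) := by
  have he0 : e ≠ 0 := norm_ne_zero_iff.1 (by rw [he]; exact one_ne_zero)
  have hhc : Continuous fun z => Real.sin z ^ c := Real.continuous_sin.rpow_const fun _ => Or.inr hc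
  have hdiff : ∀ᵐ w, w ∈ Ioo (0:ℝ) 1 → DifferentiableAt ℝ (fun t => angle e (D t)) w := by
    have : ∀ n : ℕ, ∀ᵐ w, w ∈ Icc (1 / ((n:ℝ) + 2)) (1 - 1 / ((n:ℝ) + 2)) →
        DifferentiableAt ℝ (fun t => angle e (D t)) w := by
      intro n
      have hn : (0:ℝ) < n + 2 := by positivity
      have h2 : 1 / ((n:ℝ) + 2) ≤ 1 / 2 :=
        one_div_le_one_div_of_le (by norm_num) (by linarith [n.cast_nonneg (α := ℝ)])
      refine ae_differentiableAt_angle hD (by linarith) fun t ht => h0 t ?_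
      have h3 : 0 < 1 / ((n:ℝ) + 2) := by positivity
      exact ⟨by linarith [ht.1], by linarith [ht.2]⟩
    filter_upwards [ae_all_iff.2 this] with w hw hmem
    obtain ⟨n, hn⟩ := exists_nat_one_div_lt (lt_min hmem.1 (sub_pos.2 hmem.2))
    have h3 : 1 / ((n:ℝ) + 2) ≤ 1 / ((n:ℝ) + 1) :=
      one_div_le_one_div_of_le (by positivity) (by linarith)
    obtain ⟨h4, h5⟩ := lt_min_iff.1 hn
    exact hw n ⟨by linarith, by linarith⟩
  have hbd : ∀ᵐ w, w ∈ Ioo (0:ℝ) 1 →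
      |deriv (fun t => angle e (D t)) w| ≤ ‖projPerp (D w) (deriv D w)‖ / ‖D w‖ ∧
      Real.sin (angle e (D w)) * deriv (fun t => angle e (D t)) w =
        -⟪e, projPerp (D w) (deriv D w)⟫ / ‖D w‖ := by
    filter_upwards [hdiff, hD.ae_differentiableAt_real] with w h1 h2 hw
    exact deriv_angle_bounds he h2.hasDerivAt (h0 w hw) (h1 hw).hasDerivAt
  have hrestr : ∀ {P : ℝ → Prop}, (∀ᵐ w, w ∈ Ioo (0:ℝ) 1 → P w) →
      ∀ᵐ w ∂(volume.restrict (Ioc (0:ℝ) 1)), P w := by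
    intro P hP
    rw [← Measure.restrict_congr_set Ioo_ae_eq_Ioc]
    exact (ae_restrict_iff' measurableSet_Ioo).2 hP
  set ψ : ℝ → ℝ := fun w => Real.sin (angle e (D w)) ^ c * deriv (fun t => angle e (D t)) w with hψ
  have hle : ∀ᵐ w ∂(volume.restrict (Ioc (0:ℝ) 1)), ‖ψ w‖ ≤ Real.sin (angle e (D w)) ^ c *
      (‖projPerp (D w) (deriv D w)‖ / ‖D w‖) := by
    filter_upwards [hrestr hbd] with w hw
    rw [hψ, norm_mul, Real.norm_eq_abs, Real.norm_eq_abs,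
      abs_of_nonneg (Real.rpow_nonneg (sin_angle_nonneg _ _) _)]
    exact mul_le_mul_of_nonneg_left hw.1 (Real.rpow_nonneg (sin_angle_nonneg _ _) _)
  have hψm : Measurable ψ :=
    ((Real.measurable_sin.comp
      (measurable_angle measurable_const hD.continuous.measurable)).pow_const
      c).mul (measurable_deriv _)
  have hψi : IntegrableOn ψ (Ioc 0 1) := hint.mono' hψm.aestronglyMeasurable hle
  have hlim0 : Tendsto (fun δ : ℝ => δ) (𝓝[>] 0) (𝓝 0) := tendsto_id.mono_left nhdsWithin_le_nhds
  have hlim1 : Tendsto (fun δ : ℝ => 1 - δ) (𝓝[>] 0) (𝓝 1) := by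
    simpa using tendsto_const_nhds.sub hlim0
  have hlim1' : Tendsto (fun δ : ℝ => 1 - δ) (𝓝[>] 0) (𝓝[<] 1) := by
    refine tendsto_nhdsWithin_of_tendsto_nhds_of_eventually_within _ hlim1 ?_
    filter_upwards [self_mem_nhdsWithin] with δ hδ
    simpa using hδ
  have hT1 := (aecover_Ioc_of_Icc (μ := (volume : Measure ℝ)) hlim0
    hlim1).integral_tendsto_of_countably_generated hψi
  have hF : Continuous fun z => ∫ y in (0:ℝ)..z, Real.sin y ^ c :=
    continuous_iff_continuousAt.2 fun x =>
      (hhc.integral_hasStrictDerivAt 0 x).hasDerivAt.continuousAt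
  have hT2 : Tendsto (fun δ : ℝ => (∫ y in (0:ℝ)..angle e (D (1 - δ)), Real.sin y ^ c) -
      ∫ y in (0:ℝ)..angle e (D δ), Real.sin y ^ c) (𝓝[>] 0)
      (𝓝 ((∫ y in (0:ℝ)..π, Real.sin y ^ c) - ∫ y in (0:ℝ)..0, Real.sin y ^ c)) :=
    ((hF.tendsto π).comp ((tendsto_angle_left he0 hr hD1).comp hlim1')).sub
      ((hF.tendsto 0).comp (tendsto_angle_right he0 hl hD0))
  rw [intervalIntegral.integral_same, sub_zero] at hT2
  have hval : ∫ w in Ioc (0:ℝ) 1, ψ w = ∫ z in (0:ℝ)..π, Real.sin z ^ c := by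
    refine tendsto_nhds_unique hT1 (hT2.congr' ?_)
    filter_upwards [Ioo_mem_nhdsGT (show (0:ℝ) < 1 / 2 by norm_num)] with δ hδ
    have hδ1 : δ ≤ 1 - δ := by linarith [hδ.2]
    have hsub : Icc δ (1 - δ) ⊆ Ioc (0:ℝ) 1 := fun x hx =>
      ⟨hδ.1.trans_le hx.1, by linarith [hx.2, hδ.1]⟩
    rw [Measure.restrict_restrict measurableSet_Icc, inter_eq_left.2 hsub,
      integral_Icc_eq_integral_Ioc, ← intervalIntegral.integral_of_le hδ1,
      integral_comp_angle_mul_deriv hD hδ1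
        (fun t ht => h0 t ⟨hδ.1.trans_le ht.1, by linarith [ht.2, hδ.1]⟩) hhc]
    exact integral_interval_sub_left (hhc.intervalIntegrable _ _) (hhc.intervalIntegrable _ _)
  have hle' : ψ ≤ᵐ[volume.restrict (Ioc (0:ℝ) 1)] fun w => Real.sin (angle e (D w)) ^ c *
      (‖projPerp (D w) (deriv D w)‖ / ‖D w‖) := by
    filter_upwards [hle] with w hw using (le_abs_self _).trans hw
  rw [← hval]
  refine ⟨integral_mono_ae hψi hint hle', fun heq => ?_⟩
  have hae := (integral_eq_iff_of_ae_le hψi hint hle').1 heq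
  rw [← Measure.restrict_congr_set Ioo_ae_eq_Ioc] at hae
  have hae' := (ae_restrict_iff' measurableSet_Ioo).1 hae
  filter_upwards [hae', hbd] with w h1 h2 hw
  have hn : ‖D w‖ ≠ 0 := norm_ne_zero_iff.2 (h0 w hw)
  have h3 := (h2 hw).2
  rcases (sin_angle_nonneg e (D w)).eq_or_lt with hs | hs
  · rw [← hs, zero_mul] at h3 ⊢
    have := (div_eq_zero_iff.1 h3.symm).resolve_right hn
    exact this.symm
  · have h4 := mul_left_cancel₀ (Real.rpow_pos_of_pos hs c).ne' (h1 hw)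
    rw [h4, mul_div_assoc', div_left_inj' hn] at h3
    exact h3

end AngleSweep

section UnitLoop

open InnerProductGeometry Filter Topology

variable {E : Type*} [NormedAddCommGroup E] [InnerProductSpace ℝ E]

/-- A closed curve of zero mean winds by at least `2 * π` as seen from the origin. -/
lemma two_pi_le_integral_of_angle_le {D : ℝ → E} (hD : Continuous D) (h1 : D 1 = D 0)
    (h0 : ∀ t, D t ≠ 0) (hmean : ∀ v, ∫ t in (0:ℝ)..1, ⟪D t, v⟫ = 0) {g : ℝ → ℝ}
    (hg : IntervalIntegrable g volume 0 1)
    (hang : ∀ s t, 0 ≤ s → s ≤ t → t ≤ 1 → angle (D s) (D t) ≤ ∫ x in s..t, g x) :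
    2 * π ≤ ∫ t in (0:ℝ)..1, g t := by
  have hi : ∀ s t, 0 ≤ s → s ≤ t → t ≤ 1 → IntervalIntegrable g volume s t := fun s t hs hst ht =>
    hg.mono_set (by rw [uIcc_of_le hst, uIcc_of_le zero_le_one]; exact Icc_subset_Icc hs ht)
  set T := ∫ t in (0:ℝ)..1, g t with hT
  have hT0 : 0 ≤ T := (angle_nonneg _ _).trans (hang 0 1 le_rfl zero_le_one le_rfl)
  have hGc : ContinuousOn (fun t => ∫ x in (0:ℝ)..t, g x) (Icc 0 1) := by
    have := continuousOn_primitive_interval (μ := volume) (f := g) (a := 0) (b := 1)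
      ((intervalIntegrable_iff_integrableOn_Icc_of_le zero_le_one).1 hg |>.mono_set
        (by rw [uIcc_of_le zero_le_one]))
    rwa [uIcc_of_le zero_le_one] at this
  obtain ⟨t1, ht1, hGt1⟩ : T / 2 ∈ (fun t => ∫ x in (0:ℝ)..t, g x) '' Icc 0 1 := by
    refine intermediate_value_Icc zero_le_one hGc ?_
    rw [intervalIntegral.integral_same]
    exact ⟨by linarith, by linarith⟩
  have hGt2 : ∫ x in t1..1, g x = T / 2 := by
    have := integral_add_adjacent_intervals (hi 0 t1 le_rfl ht1.1 ht1.2)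
      (hi t1 1 ht1.1 ht1.2 le_rfl)
    simp only at hGt1
    linarith
  set v := ‖D 0‖⁻¹ • D 0 + ‖D t1‖⁻¹ • D t1 with hv
  obtain ⟨t, ht, hle⟩ : ∃ t ∈ Icc (0:ℝ) 1, ⟪D t, v⟫ ≤ 0 := by
    by_contra! hcon
    have hc : Continuous fun t => ⟪D t, v⟫ := hD.inner continuous_const
    have := intervalIntegral_pos_of_pos_on (hc.intervalIntegrable 0 1)
      (fun x hx => hcon x (Ioo_subset_Icc_self hx)) zero_lt_one
    exact this.ne' (hmean v)
  have hsum : π ≤ angle (D 0) (D t) + angle (D t1) (D t) := by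
    have hn := norm_pos_iff.2 (h0 t)
    have e1 : ⟪D t, v⟫ =
        ‖D t‖ * (Real.cos (angle (D 0) (D t)) + Real.cos (angle (D t1) (D t))) := by
      rw [hv, inner_add_right, real_inner_smul_right, real_inner_smul_right, angle_comm (D 0),
        angle_comm (D t1), cos_angle, cos_angle]
      have := (norm_pos_iff.2 (h0 0)).ne'
      have := (norm_pos_iff.2 (h0 t1)).ne'
      field_simp
    rw [e1] at hle
    have hcos : Real.cos (angle (D 0) (D t)) ≤ Real.cos (π - angle (D t1) (D t)) := by
      rw [Real.cos_pi_sub]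
      nlinarith
    by_contra! hcon
    refine absurd (Real.strictAntiOn_cos ⟨angle_nonneg _ _, angle_le_pi _ _⟩
      ⟨sub_nonneg.2 (angle_le_pi (D t1) (D t)), by linarith [angle_nonneg (D t1) (D t)]⟩
      (by linarith : angle (D 0) (D t) < π - angle (D t1) (D t))) hcos.not_gt
  rcases le_total t t1 with h | h
  · have a1 := hang 0 t le_rfl ht.1 ht.2
    have a2 := hang t t1 ht.1 h ht1.2
    have a3 := integral_add_adjacent_intervals (hi 0 t le_rfl ht.1 ht.2) (hi t t1 ht.1 h ht1.2)
    rw [angle_comm] at a2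
    simp only at hGt1
    linarith
  · have a1 := hang t1 t ht1.1 h ht.2
    have a2 := hang t 1 ht.1 ht.2 le_rfl
    have a3 := integral_add_adjacent_intervals (hi t1 t ht1.1 h ht.2) (hi t 1 ht.1 ht.2 le_rfl)
    rw [h1, angle_comm] at a2
    linarith

/-- A simple closed curve of length one parametrized by arc length. -/
structure IsUnitLoop (γ : ℝ → E) : Prop where
  lip : LipschitzWith 1 γ
  per : Function.Periodic γ 1
  inj : ∀ s t, γ s = γ t → ∃ k : ℤ, s - t = k
  speed : ∀ᵐ t : ℝ, ‖deriv γ t‖ = 1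

/-- The length of the chord from `γ u` to `γ (u + w)`. -/
def chord (γ : ℝ → E) (u w : ℝ) : ℝ := ‖γ (u + w) - γ u‖

/-- The sine of the angle between the tangent at `u` and the chord to `u + w`. -/
def sinL (γ : ℝ → E) (u w : ℝ) : ℝ := Real.sin (angle (deriv γ u) (γ (u + w) - γ u))

/-- The sine of the angle between the chord from `u` and the tangent at `u + w`. -/
def sinR (γ : ℝ → E) (u w : ℝ) : ℝ := Real.sin (angle (γ (u + w) - γ u) (deriv γ (u + w)))

lemma sinL_nonneg (γ : ℝ → E) (u w : ℝ) : 0 ≤ sinL γ u w := sin_angle_nonneg _ _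

lemma sinR_nonneg (γ : ℝ → E) (u w : ℝ) : 0 ≤ sinR γ u w := sin_angle_nonneg _ _

lemma sinL_le_one (γ : ℝ → E) (u w : ℝ) : sinL γ u w ≤ 1 := Real.sin_le_one _

lemma sinR_le_one (γ : ℝ → E) (u w : ℝ) : sinR γ u w ≤ 1 := Real.sin_le_one _

namespace IsUnitLoop

variable {γ : ℝ → E} (hγ : IsUnitLoop γ)

include hγ

lemma sub_ne_zero (u : ℝ) {w : ℝ} (hw : w ∈ Ioo (0:ℝ) 1) : γ (u + w) - γ u ≠ 0 := by
  intro h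
  obtain ⟨k, hk⟩ := hγ.inj _ _ (sub_eq_zero.1 h)
  rw [add_sub_cancel_left] at hk
  rw [hk] at hw
  have h1 : (0:ℤ) < k := by exact_mod_cast hw.1
  have h2 : k < (1:ℤ) := by exact_mod_cast hw.2
  omega

lemma chord_pos (u : ℝ) {w : ℝ} (hw : w ∈ Ioo (0:ℝ) 1) : 0 < chord γ u w :=
  norm_pos_iff.2 (hγ.sub_ne_zero u hw)

lemma chord_le (u : ℝ) {w : ℝ} (hw : 0 ≤ w) : chord γ u w ≤ w := by
  have := hγ.lip.dist_le_mul (u + w) u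
  rw [dist_eq_norm, Real.dist_eq, add_sub_cancel_left, abs_of_nonneg hw] at this
  simpa [chord] using this

lemma deriv_periodic : Function.Periodic (deriv γ) 1 := by
  intro t
  have h1 : deriv (fun x => γ (x + 1)) t = deriv γ (t + 1) := deriv_comp_add_const γ 1 t
  have h2 : (fun x => γ (x + 1)) = γ := funext hγ.per
  rw [← h1, h2]

omit hγ in
lemma hasDerivAt_of_norm_deriv {u : ℝ} (hu : ‖deriv γ u‖ = 1) :
    HasDerivAt γ (deriv γ u) u := by
  have : deriv γ u ≠ 0 := norm_ne_zero_iff.1 (by rw [hu]; exact one_ne_zero)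
  exact (differentiableAt_of_deriv_ne_zero this).hasDerivAt

lemma lipschitz_secant (u : ℝ) : LipschitzWith 1 fun w => γ (u + w) - γ u := by
  refine LipschitzWith.of_dist_le_mul fun x y => ?_
  have := hγ.lip.dist_le_mul (u + x) (u + y)
  simpa using this

lemma lipschitz_shift (w : ℝ) : LipschitzWith 2 fun t => γ (t + w) - γ t := by
  have h1 : LipschitzWith 1 fun t => γ (t + w) := by
    refine LipschitzWith.of_dist_le_mul fun x y => ?_
    have := hγ.lip.dist_le_mul (x + w) (y + w)
    simpa using this
  have := h1.sub hγ.lip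
  norm_num at this
  exact this

lemma ae_speed_add (w : ℝ) : ∀ᵐ t : ℝ, ‖deriv γ (t + w)‖ = 1 :=
  (measurePreserving_add_right volume w).quasiMeasurePreserving.ae hγ.speed

lemma integral_shift_eq_zero [CompleteSpace E] (w : ℝ) :
    ∫ t in (0:ℝ)..1, (γ (t + w) - γ t) = 0 := by
  have hc := hγ.lip.continuous
  rw [intervalIntegral.integral_sub
    ((by fun_prop : Continuous fun t => γ (t + w)).intervalIntegrable _ _)
    (hc.intervalIntegrable _ _), intervalIntegral.integral_comp_add_right γ w]
  have := hγ.per.intervalIntegral_add_eq w 0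
  rw [zero_add] at this ⊢
  rw [add_comm 1 w, this, sub_self]

variable [FiniteDimensional ℝ E] [MeasurableSpace E] [BorelSpace E]

omit hγ [InnerProductSpace ℝ E] [FiniteDimensional ℝ E] [MeasurableSpace E] [BorelSpace E] in
lemma measurable_chord (hc : Continuous γ) : Measurable fun x : ℝ × ℝ => chord γ x.1 x.2 := by
  unfold chord
  exact (by fun_prop : Continuous fun x : ℝ × ℝ => ‖γ (x.1 + x.2) - γ x.1‖).measurable

omit hγ in
lemma measurable_sinL (hc : Continuous γ) : Measurable fun x : ℝ × ℝ => sinL γ x.1 x.2 := by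
  unfold sinL
  exact Real.measurable_sin.comp (measurable_angle ((measurable_deriv γ).comp measurable_fst)
    (by fun_prop : Continuous fun x : ℝ × ℝ => γ (x.1 + x.2) - γ x.1).measurable)

omit hγ in
lemma measurable_sinR (hc : Continuous γ) : Measurable fun x : ℝ × ℝ => sinR γ x.1 x.2 := by
  unfold sinR
  exact Real.measurable_sin.comp (measurable_angle
    (by fun_prop : Continuous fun x : ℝ × ℝ => γ (x.1 + x.2) - γ x.1).measurable
    ((measurable_deriv γ).comp (measurable_fst.add measurable_snd)))

omit [FiniteDimensional ℝ E] [MeasurableSpace E] [BorelSpace E] in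
lemma exists_le_chord {w : ℝ} (hw : w ∈ Ioo (0:ℝ) 1) : ∃ m, 0 < m ∧ ∀ u, m ≤ chord γ u w := by
  have hc := hγ.lip.continuous
  have hcc : Continuous fun u => chord γ u w := by unfold chord; fun_prop
  obtain ⟨t0, ht0, hmin⟩ := isCompact_Icc.exists_isMinOn (nonempty_Icc.2 (zero_le_one' ℝ))
    hcc.continuousOn
  refine ⟨chord γ t0 w, hγ.chord_pos _ hw, fun u => ?_⟩
  have hper : Function.Periodic (fun u => chord γ u w) 1 := by
    intro t
    simp only [chord]
    rw [hγ.per t, add_right_comm, hγ.per (t + w)]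
  obtain ⟨y, hy, hyu⟩ := hper.exists_mem_Ico₀ one_pos u
  rw [hyu]
  exact hmin ⟨hy.1, hy.2.le⟩

lemma integrableOn_sin_add_sin {w : ℝ} (hw : w ∈ Ioo (0:ℝ) 1) :
    IntegrableOn (fun u => (sinL γ u w + sinR γ u w) / chord γ u w) (Ioc 0 1) := by
  obtain ⟨m, hm, hmu⟩ := hγ.exists_le_chord hw
  have hc := hγ.lip.continuous
  refine Integrable.mono' (g := fun _ => 2 / m) (integrable_const _) ?_ ?_
  · exact ((((measurable_sinL hc).comp (measurable_id.prodMk measurable_const)).add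
      ((measurable_sinR hc).comp (measurable_id.prodMk measurable_const))).div
      ((measurable_chord hc).comp (measurable_id.prodMk measurable_const))).aestronglyMeasurable
  · refine ae_of_all _ fun u => ?_
    have h1 := hmu u
    have h2 := sinL_nonneg γ u w
    have h3 := sinR_nonneg γ u w
    rw [Real.norm_of_nonneg (by have := hm.trans_le h1; positivity)]
    have h4 := sinL_le_one γ u w
    have h5 := sinR_le_one γ u w
    gcongr
    linarith

lemma two_pi_le_integral {w : ℝ} (hw : w ∈ Ioo (0:ℝ) 1) :
    2 * π ≤ ∫ u in Ioc (0:ℝ) 1, (sinL γ u w + sinR γ u w) / chord γ u w := by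
  have hint := hγ.integrableOn_sin_add_sin hw
  have hii := (intervalIntegrable_iff_integrableOn_Ioc_of_le zero_le_one).2 hint
  have hlip := hγ.lipschitz_shift w
  rw [← intervalIntegral.integral_of_le zero_le_one]
  refine two_pi_le_integral_of_angle_le (D := fun t => γ (t + w) - γ t) hlip.continuous ?_
    (fun t => hγ.sub_ne_zero t hw) ?_ hii ?_
  · rw [add_comm 1 w, hγ.per w, ← hγ.per 0, zero_add, zero_add]
  · intro v
    have h1 := hγ.integral_shift_eq_zero w
    have hI : IntervalIntegrable (fun t => γ (t + w) - γ t) volume 0 1 :=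
      hlip.continuous.intervalIntegrable 0 1
    rw [intervalIntegral.integral_of_le zero_le_one] at h1 ⊢
    have h2 := integral_inner (𝕜 := ℝ)
      ((intervalIntegrable_iff_integrableOn_Ioc_of_le zero_le_one).1 hI) v
    rw [h1, inner_zero_right] at h2
    simpa only [real_inner_comm] using h2
  · intro s t hs hst ht
    have hDs := hγ.sub_ne_zero s hw
    set e := ‖γ (s + w) - γ s‖⁻¹ • (γ (s + w) - γ s) with he
    have he1 : ‖e‖ = 1 := by
      rw [he, norm_smul, norm_inv, norm_norm, inv_mul_cancel₀ (norm_ne_zero_iff.2 hDs)]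
    have hae : ∀ x : E, angle e x = angle (γ (s + w) - γ s) x := fun x =>
      angle_smul_left_of_pos _ _ (inv_pos.2 (norm_pos_iff.2 hDs))
    have hftc := integral_comp_angle_mul_deriv (e := e) (h := fun _ => 1) hlip hst
      (fun t _ => hγ.sub_ne_zero t hw) continuous_const
    simp only [one_mul, intervalIntegral.integral_const, smul_eq_mul, mul_one] at hftc
    rw [hae, hae, angle_self hDs, sub_zero] at hftc
    rw [← hftc]
    have hd := ae_differentiableAt_angle (e := e) hlip hst (fun t _ => hγ.sub_ne_zero t hw)
    obtain ⟨C, hC⟩ := exists_lipschitzOn_angle_Icc (e := e) hlip hst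
      (fun t _ => hγ.sub_ne_zero t hw)
    rw [← uIcc_of_le hst] at hC
    rw [intervalIntegral.integral_of_le hst, intervalIntegral.integral_of_le hst]
    refine setIntegral_mono_ae_restrict
      (hC.absolutelyContinuousOnInterval.intervalIntegrable_deriv.1)
      (hint.mono_set (Ioc_subset_Ioc hs ht)) ?_
    refine (ae_restrict_iff' measurableSet_Ioc).2 ?_
    filter_upwards [hd, hγ.speed, hγ.ae_speed_add w] with y h1 h2 h3 hy
    have h4 : HasDerivAt (fun t => γ (t + w) - γ t) (deriv γ (y + w) - deriv γ y) y :=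
      ((hasDerivAt_of_norm_deriv h3).comp_add_const y w).sub (hasDerivAt_of_norm_deriv h2)
    have h5 := (deriv_angle_bounds he1 h4 (hγ.sub_ne_zero y hw)
      (h1 (Ioc_subset_Icc_self hy)).hasDerivAt).1
    refine (le_abs_self _).trans (h5.trans ?_)
    have h6 := norm_projPerp_sub_le (hγ.sub_ne_zero y hw) (deriv γ (y + w)) (deriv γ y)
    rw [h2, h3, mul_one, mul_one, angle_comm _ (deriv γ y)] at h6
    simp only [sinL, sinR, chord]
    rw [add_comm (Real.sin _)]
    gcongr

end IsUnitLoop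

end UnitLoop

section FourierBound

open Filter Topology

lemma abs_sin_nat_mul_le (n : ℕ) (x : ℝ) : |Real.sin (n * x)| ≤ n * |Real.sin x| := by
  induction n with
  | zero => simp
  | succ n ih =>
    have h1 : Real.sin ((n + 1 : ℕ) * x) =
        Real.sin (n * x) * Real.cos x + Real.cos (n * x) * Real.sin x := by
      rw [← Real.sin_add]; push_cast; ring_nf
    rw [h1]
    refine (abs_add_le _ _).trans ?_
    rw [abs_mul, abs_mul]
    have h2 := Real.abs_cos_le_one x
    have h3 := Real.abs_cos_le_one (n * x)
    have h4 : |Real.sin (n * x)| * |Real.cos x| ≤ n * |Real.sin x| :=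
      (mul_le_of_le_one_right (abs_nonneg _) h2).trans ih
    have h5 : |Real.cos (n * x)| * |Real.sin x| ≤ |Real.sin x| :=
      mul_le_of_le_one_left (abs_nonneg _) h3
    push_cast
    linarith

lemma abs_sin_nat_mul_lt {n : ℕ} (hn : 2 ≤ n) {x : ℝ} (hx : Real.sin x ≠ 0) :
    |Real.sin (n * x)| < n * |Real.sin x| := by
  obtain ⟨m, rfl⟩ : ∃ m, n = m + 1 := ⟨n - 1, by omega⟩
  have h1 : Real.sin ((m + 1 : ℕ) * x) =
      Real.sin (m * x) * Real.cos x + Real.cos (m * x) * Real.sin x := by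
    rw [← Real.sin_add]; push_cast; ring_nf
  rw [h1]
  refine (abs_add_le _ _).trans_lt ?_
  rw [abs_mul, abs_mul]
  have hs : 0 < |Real.sin x| := abs_pos.2 hx
  have h2 : |Real.cos x| < 1 := by
    rw [← sq_lt_one_iff_abs_lt_one]
    have := Real.sin_sq_add_cos_sq x
    have : 0 < Real.sin x ^ 2 := by positivity
    linarith
  have h3 := Real.abs_cos_le_one (m * x)
  have hm : (0:ℝ) < m := by exact_mod_cast (by omega : 0 < m)
  have h4 : |Real.sin (m * x)| * |Real.cos x| < m * |Real.sin x| :=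
    (mul_le_mul_of_nonneg_right (abs_sin_nat_mul_le m x) (abs_nonneg _)).trans_lt
      (mul_lt_of_lt_one_right (by positivity) h2)
  have h5 : |Real.cos (m * x)| * |Real.sin x| ≤ |Real.sin x| :=
    mul_le_of_le_one_left (abs_nonneg _) h3
  push_cast
  linarith

lemma sin_int_mul_sq (k : ℤ) (x : ℝ) : Real.sin (k * x) ^ 2 = Real.sin (k.natAbs * x) ^ 2 := by
  rcases Int.natAbs_eq k with h | h
  · conv_lhs => rw [h]
    simp
  · conv_lhs => rw [h]
    simp

lemma sin_int_mul_sq_le (k : ℤ) (x : ℝ) :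
    Real.sin (k * x) ^ 2 ≤ (k:ℝ) ^ 2 * Real.sin x ^ 2 := by
  rw [sin_int_mul_sq, ← mul_pow, ← sq_abs, ← sq_abs (_ * _), abs_mul, ← Int.cast_abs,
    Int.abs_eq_natAbs, Int.cast_natCast]
  exact pow_le_pow_left₀ (abs_nonneg _) (abs_sin_nat_mul_le _ _) 2

lemma sin_int_mul_sq_lt {k : ℤ} (hk : 2 ≤ k.natAbs) {x : ℝ} (hx : Real.sin x ≠ 0) :
    Real.sin (k * x) ^ 2 < (k:ℝ) ^ 2 * Real.sin x ^ 2 := by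
  rw [sin_int_mul_sq, ← mul_pow, ← sq_abs, ← sq_abs (_ * _), abs_mul, ← Int.cast_abs,
    Int.abs_eq_natAbs, Int.cast_natCast]
  exact pow_lt_pow_left₀ (abs_sin_nat_mul_lt hk hx) (abs_nonneg _) (by norm_num)

/-- The discrete form of the sharp chord inequality. -/
lemma chord_sq_bound_of_hasSum {a : ℤ → ℝ} (ha : ∀ k, 0 ≤ a k) {R : ℝ → ℝ}
    (hR : ∀ w, HasSum (fun k : ℤ => 4 * Real.sin (k * (π * w)) ^ 2 * a k) (R w))
    (hRw : ∀ w ∈ Ioo (0:ℝ) 1, R w ≤ w ^ 2) {w : ℝ} (hw : w ∈ Ioo (0:ℝ) 1) :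
    R w ≤ Real.sin (π * w) ^ 2 / π ^ 2 ∧
      (Real.sin (π * w) ^ 2 / π ^ 2 ≤ R w → ∀ k : ℤ, 2 ≤ k.natAbs → a k = 0) := by
  have hfin : ∀ s : Finset ℤ, ∑ k ∈ s, 4 * π ^ 2 * (k:ℝ) ^ 2 * a k ≤ 1 := by
    intro s
    have hlim : Tendsto (fun w : ℝ => ∑ k ∈ s, 4 * (Real.sin (k * (π * w)) / w) ^ 2 * a k) (𝓝[>] 0)
        (𝓝 (∑ k ∈ s, 4 * (k * π) ^ 2 * a k)) := by
      refine tendsto_finsetSum _ fun k _ => ?_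
      have hd : HasDerivAt (fun w : ℝ => Real.sin (k * (π * w))) (k * π) 0 := by
        have h1 : HasDerivAt (fun w : ℝ => k * (π * w)) (k * (π * 1)) 0 :=
          ((hasDerivAt_id 0).const_mul π).const_mul (k:ℝ)
        simpa using h1.sin
      have h2 := (hasDerivAt_iff_tendsto_slope_zero.1 hd).mono_left (nhdsGT_le_nhdsNE (0:ℝ))
      refine ((Tendsto.pow ?_ 2).const_mul 4).mul_const (a k)
      refine h2.congr fun t => ?_
      simp [div_eq_inv_mul]
    have hle : ∀ᶠ w in 𝓝[>] (0:ℝ),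
        ∑ k ∈ s, 4 * (Real.sin (k * (π * w)) / w) ^ 2 * a k ≤ 1 := by
      filter_upwards [Ioo_mem_nhdsGT (zero_lt_one' ℝ)] with w hw
      have h1 := sum_le_hasSum s (fun k _ => by have := ha k; positivity) (hR w)
      have h2 := h1.trans (hRw w hw)
      have hw2 : 0 < w ^ 2 := pow_pos hw.1 2
      have : ∑ k ∈ s, 4 * (Real.sin (k * (π * w)) / w) ^ 2 * a k =
          (∑ k ∈ s, 4 * Real.sin (k * (π * w)) ^ 2 * a k) / w ^ 2 := by
        rw [Finset.sum_div]
        refine Finset.sum_congr rfl fun k _ => ?_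
        rw [div_pow]; ring
      rw [this]
      exact (div_le_one hw2).2 h2
    have := le_of_tendsto hlim hle
    refine le_trans (le_of_eq ?_) this
    exact Finset.sum_congr rfl fun k _ => by ring
  have hsum : Summable fun k : ℤ => 4 * π ^ 2 * (k:ℝ) ^ 2 * a k :=
    summable_of_sum_le (fun k => by have := ha k; positivity) hfin
  have htsum : ∑' k : ℤ, 4 * π ^ 2 * (k:ℝ) ^ 2 * a k ≤ 1 :=
    hsum.tsum_le_of_sum_le hfin
  have hs := hsum.hasSum.mul_left (Real.sin (π * w) ^ 2 / π ^ 2)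
  have hterm : ∀ k : ℤ, 4 * Real.sin (k * (π * w)) ^ 2 * a k ≤
      Real.sin (π * w) ^ 2 / π ^ 2 * (4 * π ^ 2 * (k:ℝ) ^ 2 * a k) := by
    intro k
    have := mul_le_mul_of_nonneg_right (sin_int_mul_sq_le k (π * w)) (ha k)
    have e : Real.sin (π * w) ^ 2 / π ^ 2 * (4 * π ^ 2 * (k:ℝ) ^ 2 * a k) =
      4 * ((k:ℝ) ^ 2 * Real.sin (π * w) ^ 2 * a k) := by field_simp
    rw [e]; linarith
  have hb : Real.sin (π * w) ^ 2 / π ^ 2 * ∑' k : ℤ, 4 * π ^ 2 * (k:ℝ) ^ 2 * a k ≤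
      Real.sin (π * w) ^ 2 / π ^ 2 := mul_le_of_le_one_right (by positivity) htsum
  refine ⟨(hasSum_le hterm (hR w) hs).trans hb, fun heq k hk => ?_⟩
  by_contra hne
  have hak := lt_of_le_of_ne (ha k) (Ne.symm hne)
  have hsin : Real.sin (π * w) ≠ 0 :=
    (Real.sin_pos_of_pos_of_lt_pi (by have := hw.1; positivity)
      (by have := hw.2; nlinarith [Real.pi_pos])).ne'
  have hlt : 4 * Real.sin (k * (π * w)) ^ 2 * a k <
      Real.sin (π * w) ^ 2 / π ^ 2 * (4 * π ^ 2 * (k:ℝ) ^ 2 * a k) := by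
    have := mul_lt_mul_of_pos_right (sin_int_mul_sq_lt hk hsin) hak
    have e : Real.sin (π * w) ^ 2 / π ^ 2 * (4 * π ^ 2 * (k:ℝ) ^ 2 * a k) =
      4 * ((k:ℝ) ^ 2 * Real.sin (π * w) ^ 2 * a k) := by field_simp
    rw [e]; linarith
  exact absurd (hasSum_lt hterm hlt (hR w) hs) (not_lt.2 (hb.trans heq))

local instance : Fact ((0:ℝ) < 1) := ⟨one_pos⟩

section Scalar

variable {f : ℝ → ℂ} (hf : Continuous f) (hper : Function.Periodic f 1)

include hper

lemma fourierCoeff_lift_shift (w : ℝ) (k : ℤ) :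
    (∫ t in (0:ℝ)..1, fourier (-k) (t : AddCircle (1:ℝ)) • f (t + w)) =
      fourier k (w : AddCircle (1:ℝ)) * fourierCoeff hper.lift k := by
  have hlift : ∀ x : ℝ, hper.lift (x : AddCircle (1:ℝ)) = f x := hper.lift_coe
  rw [fourierCoeff_eq_intervalIntegral _ k w]
  simp only [hlift, div_one, one_smul]
  have h1 := intervalIntegral.integral_comp_add_right (a := 0) (b := 1)
    (fun t : ℝ => fourier k (w : AddCircle (1:ℝ)) * (fourier (-k) (t : AddCircle (1:ℝ)) • f t)) w
  rw [zero_add, add_comm 1 w] at h1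
  rw [← intervalIntegral.integral_const_mul, ← h1]
  refine intervalIntegral.integral_congr fun t _ => ?_
  simp only [smul_eq_mul, fourier_coe_apply]
  rw [← mul_assoc, ← Complex.exp_add]
  congr 2
  push_cast
  ring

include hf

lemma hasSum_sq_sub_shift (w : ℝ) :
    HasSum (fun k : ℤ => 4 * Real.sin (k * (π * w)) ^ 2 * ‖fourierCoeff hper.lift k‖ ^ 2)
      (∫ u in (0:ℝ)..1, ‖f (u + w) - f u‖ ^ 2) := by
  have hcd : Continuous fun u => f (u + w) - f u := by fun_prop
  obtain ⟨M, hM⟩ := isCompact_Icc.exists_bound_of_continuousOn (s := Icc 0 1) hcd.continuousOn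
  have hmem : MemLp (fun u => f (u + w) - f u) 2 (volume.restrict (Ioc (0:ℝ) 1)) :=
    MemLp.of_bound hcd.aestronglyMeasurable M
      ((ae_restrict_iff' measurableSet_Ioc).2
        (ae_of_all _ fun u hu => hM u (Ioc_subset_Icc_self hu)))
  have h := hasSum_sq_fourierCoeffOn zero_lt_one hmem
  simp only [sub_zero, inv_one, one_smul] at h
  convert h using 2 with k
  symm
  have h0 := fourierCoeff_lift_shift hper 0 k
  have h1 := fourierCoeff_lift_shift hper w k
  have hcoef : fourierCoeffOn zero_lt_one (fun u => f (u + w) - f u) k =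
      (fourier k (w : AddCircle (1:ℝ)) - 1) * fourierCoeff hper.lift k := by
    have h2 : fourierCoeffOn zero_lt_one (fun u => f (u + w) - f u) k =
        (∫ t in (0:ℝ)..1, fourier (-k) (t : AddCircle (1:ℝ)) • f (t + w)) -
          ∫ t in (0:ℝ)..1, fourier (-k) (t : AddCircle (1:ℝ)) • f (t + 0) := by
      rw [fourierCoeffOn_eq_integral, sub_zero, div_one, one_smul,
        ← intervalIntegral.integral_sub]
      · refine intervalIntegral.integral_congr fun t _ => ?_
        simp only [fourier_coe_apply, smul_eq_mul, add_zero]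
        ring
      all_goals
        refine Continuous.intervalIntegrable ?_ _ _
        simp only [fourier_coe_apply]
        fun_prop
    rw [h2, h1, h0]
    simp
    ring
  rw [hcoef, norm_mul, mul_pow]
  congr 1
  have h3 : fourier k (w : AddCircle (1:ℝ)) =
      Complex.exp (Complex.I * ((2 * π * k * w : ℝ) : ℂ)) := by
    rw [fourier_coe_apply]
    congr 1
    push_cast
    ring
  rw [h3, Complex.norm_exp_I_mul_ofReal_sub_one, Real.norm_eq_abs, sq_abs,
    show 2 * π * k * w / 2 = k * (π * w) by ring]
  ring

lemma eq_trig_of_fourierCoeff_eq_zero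
    (h0 : ∀ k : ℤ, 2 ≤ k.natAbs → fourierCoeff hper.lift k = 0) (t : ℝ) :
    f t = fourierCoeff hper.lift 0 + Complex.cos (2 * π * t) *
      (fourierCoeff hper.lift 1 + fourierCoeff hper.lift (-1)) + Complex.sin (2 * π * t) *
      (Complex.I * (fourierCoeff hper.lift 1 - fourierCoeff hper.lift (-1))) := by
  have hcont : Continuous (hper.lift : AddCircle (1:ℝ) → ℂ) := continuous_quot_lift _ hf
  have hzero : ∀ k ∉ ({0, 1, -1} : Finset ℤ), fourierCoeff hper.lift k = 0 := by
    intro k hk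
    simp only [Finset.mem_insert, Finset.mem_singleton, not_or] at hk
    exact h0 k (by omega)
  have hsum : Summable (fourierCoeff (hper.lift : AddCircle (1:ℝ) → ℂ)) :=
    summable_of_ne_finset_zero hzero
  have h1 := has_pointwise_sum_fourier_series_of_summable (f := ⟨hper.lift, hcont⟩) hsum
    (t : AddCircle (1:ℝ))
  have h2 := hasSum_sum_of_ne_finset_zero (L := SummationFilter.unconditional ℤ)
    (s := ({0, 1, -1} : Finset ℤ))
    (f := fun i =>
      fourierCoeff (hper.lift : AddCircle (1:ℝ) → ℂ) i • fourier i (t : AddCircle (1:ℝ)))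
    (fun k hk => by rw [hzero k hk, zero_smul])
  have h3 := h1.unique h2
  have h4 : (hper.lift : AddCircle (1:ℝ) → ℂ) (t : AddCircle (1:ℝ)) = f t := hper.lift_coe t
  simp only [ContinuousMap.coe_mk] at h3
  rw [h4] at h3
  rw [h3, Finset.sum_insert (by decide), Finset.sum_insert (by decide), Finset.sum_singleton]
  simp only [fourier_coe_apply, smul_eq_mul]
  have e1 : Complex.exp (2 * π * Complex.I * (1:ℤ) * t / (1:ℝ)) =
      Complex.cos (2 * π * t) + Complex.sin (2 * π * t) * Complex.I := by
    rw [← Complex.exp_mul_I]; congr 1; push_cast; ring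
  have e2 : Complex.exp (2 * π * Complex.I * (-1:ℤ) * t / (1:ℝ)) =
      Complex.cos (2 * π * t) - Complex.sin (2 * π * t) * Complex.I := by
    have := Complex.exp_mul_I (-(2 * π * t))
    rw [Complex.cos_neg, Complex.sin_neg] at this
    rw [sub_eq_add_neg, ← neg_mul, ← this]; congr 1; push_cast; ring
  rw [e1, e2]
  simp only [Int.cast_zero, mul_zero, zero_mul, zero_div, Complex.exp_zero]
  ring

end Scalar

section Loop

variable {E : Type*} [NormedAddCommGroup E] [InnerProductSpace ℝ E]

/-- Two orthogonal vectors of the same length parametrize a round circle. -/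
lemma isCircle_range_trig {A B : E} (C : E) {R : ℝ} (hR : 0 < R) (hA : ‖A‖ = R) (hB : ‖B‖ = R)
    (hAB : ⟪A, B⟫ = 0) :
    IsCircle (range fun t : ℝ => C + Real.cos (2 * π * t) • A + Real.sin (2 * π * t) • B) := by
  have hnorm : ∀ a b : ℝ, ‖a • A + b • B‖ ^ 2 = (a ^ 2 + b ^ 2) * R ^ 2 := by
    intro a b
    rw [norm_add_sq_real, norm_smul, norm_smul, real_inner_smul_left, real_inner_smul_right, hAB,
      hA, hB, mul_pow, mul_pow, Real.norm_eq_abs, Real.norm_eq_abs, sq_abs, sq_abs]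
    ring
  have hli : LinearIndependent ℝ ![A, B] := by
    rw [LinearIndependent.pair_iff]
    intro s t hst
    have h1 := hnorm s t
    rw [hst, norm_zero] at h1
    have h2 : s ^ 2 + t ^ 2 = 0 := by
      have : R ^ 2 ≠ 0 := by positivity
      have := mul_eq_zero.1 (h1.symm.trans (by norm_num))
      tauto
    constructor <;> nlinarith [sq_nonneg s, sq_nonneg t]
  refine ⟨C, R, Submodule.span ℝ (range ![A, B]), hR, ?_, ?_⟩
  · rw [finrank_span_eq_card hli]; rfl
  have hrange : range ![A, B] = {A, B} := by simp [Matrix.range_cons, Set.pair_comm]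
  ext x
  rw [hrange]
  simp only [mem_range, mem_ofPred_eq, Submodule.mem_span_pair]
  constructor
  · rintro ⟨t, rfl⟩
    have : C + Real.cos (2 * π * t) • A + Real.sin (2 * π * t) • B - C =
        Real.cos (2 * π * t) • A + Real.sin (2 * π * t) • B := by abel
    rw [this]
    refine ⟨?_, _, _, rfl⟩
    have h := hnorm (Real.cos (2 * π * t)) (Real.sin (2 * π * t))
    rw [Real.cos_sq_add_sin_sq, one_mul] at h
    exact (sq_eq_sq₀ (norm_nonneg _) hR.le).1 h
  · rintro ⟨h1, a, b, hab⟩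
    have h2 := hnorm a b
    rw [hab, h1] at h2
    have h3 : a ^ 2 + b ^ 2 = 1 := by
      have : R ^ 2 ≠ 0 := by positivity
      exact mul_right_cancel₀ this (by linarith)
    have hz : ‖(⟨a, b⟩ : ℂ)‖ = 1 := by
      have : ‖(⟨a, b⟩ : ℂ)‖ ^ 2 = 1 ^ 2 := by
        rw [Complex.sq_norm, Complex.normSq_mk]; linarith
      exact (sq_eq_sq₀ (norm_nonneg _) zero_le_one).1 this
    have hz0 : (⟨a, b⟩ : ℂ) ≠ 0 := norm_ne_zero_iff.1 (by rw [hz]; exact one_ne_zero)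
    have hc := Complex.cos_arg hz0
    have hs := Complex.sin_arg (⟨a, b⟩ : ℂ)
    rw [hz, div_one] at hc hs
    refine ⟨Complex.arg ⟨a, b⟩ / (2 * π), ?_⟩
    have : 2 * π * (Complex.arg ⟨a, b⟩ / (2 * π)) = Complex.arg ⟨a, b⟩ := by
      field_simp
    rw [this, hc, hs, add_assoc, hab]
    abel

namespace IsUnitLoop

variable [FiniteDimensional ℝ E] {γ : ℝ → E} (hγ : IsUnitLoop γ)

include hγ

omit [FiniteDimensional ℝ E] in
/-- A loop of unit speed which is a first-order trigonometric polynomial is a round circle. -/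
lemma isCircle_of_eq_trig {A B C : E}
    (h : ∀ t, γ t = C + Real.cos (2 * π * t) • A + Real.sin (2 * π * t) • B) :
    IsCircle (range γ) := by
  have hγ' : γ = fun t => C + Real.cos (2 * π * t) • A + Real.sin (2 * π * t) • B := funext h
  have hder : ∀ t, deriv γ t =
      (2 * π) • (Real.cos (2 * π * t) • B - Real.sin (2 * π * t) • A) := by
    intro t
    have h1 : HasDerivAt (fun t : ℝ => 2 * π * t) (2 * π) t := by
      simpa using (hasDerivAt_id t).const_mul (2 * π)
    have h2 := ((hasDerivAt_const t C).add (h1.cos.smul_const A)).add (h1.sin.smul_const B)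
    rw [hγ']
    refine h2.deriv.trans ?_
    module
  have hc : Continuous fun t => ‖deriv γ t‖ := by
    simp only [hder]; fun_prop
  have hall := (hc.ae_eq_iff_eq volume continuous_const).1 hγ.speed
  have hone : ∀ t, ‖(2 * π) • (Real.cos (2 * π * t) • B - Real.sin (2 * π * t) • A)‖ = 1 := by
    intro t; rw [← hder]; exact congrFun hall t
  have hpi := Real.pi_pos
  have h0 := hone 0
  have h1 := hone (1 / 4)
  have h2 := hone (1 / 8)
  rw [show 2 * π * (1 / 4) = π / 2 by ring, Real.cos_pi_div_two, Real.sin_pi_div_two] at h1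
  rw [show 2 * π * (1 / 8) = π / 4 by ring, Real.cos_pi_div_four, Real.sin_pi_div_four] at h2
  rw [mul_zero, Real.cos_zero, Real.sin_zero] at h0
  simp only [one_smul, zero_smul, sub_zero, zero_sub, norm_neg, norm_smul, norm_mul,
    Real.norm_of_nonneg hpi.le, Real.norm_ofNat] at h0 h1
  have hB : ‖B‖ = 1 / (2 * π) := by field_simp; linarith
  have hA : ‖A‖ = 1 / (2 * π) := by field_simp; linarith
  have hAB : ⟪A, B⟫ = 0 := by
    rw [← smul_sub, norm_smul, norm_smul, Real.norm_of_nonneg (by positivity),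
      Real.norm_of_nonneg (by positivity)] at h2
    have h3 : (2 * π) ^ 2 * (1 / 2) * ‖B - A‖ ^ 2 = 1 := by
      have h4 : (√2 / 2) ^ 2 = 1 / 2 := by rw [div_pow, Real.sq_sqrt (by norm_num)]; norm_num
      rw [← h4]
      calc (2 * π) ^ 2 * (√2 / 2) ^ 2 * ‖B - A‖ ^ 2 = (2 * π * (√2 / 2 * ‖B - A‖)) ^ 2 := by ring
        _ = 1 := by rw [h2, one_pow]
    rw [norm_sub_sq_real, hA, hB, real_inner_comm] at h3
    field_simp at h3
    have h5 : π ^ 2 * ⟪A, B⟫ = 0 := by linarith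
    exact (mul_eq_zero.1 h5).resolve_left (by positivity)
  rw [hγ']
  exact isCircle_range_trig C (by positivity) hA hB hAB

omit hγ [FiniteDimensional ℝ E] in
lemma continuous_coord (hc : Continuous γ) (v : E) : Continuous fun t => ((⟪v, γ t⟫ : ℝ) : ℂ) := by
  fun_prop

omit [FiniteDimensional ℝ E] in
lemma periodic_coord (v : E) : Function.Periodic (fun t => ((⟪v, γ t⟫ : ℝ) : ℂ)) 1 := by
  intro t
  simp only [hγ.per t]

lemma integral_chord_sq {w : ℝ} (hw : w ∈ Ioo (0:ℝ) 1) :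
    ∫ u in Ioc (0:ℝ) 1, chord γ u w ^ 2 ≤ Real.sin (π * w) ^ 2 / π ^ 2 ∧
      (Real.sin (π * w) ^ 2 / π ^ 2 ≤ ∫ u in Ioc (0:ℝ) 1, chord γ u w ^ 2 →
        IsCircle (range γ)) := by
  have hcont := hγ.lip.continuous
  set b := stdOrthonormalBasis ℝ E with hb
  set F : Fin (Module.finrank ℝ E) → ℝ → ℂ := fun i t => ((⟪b i, γ t⟫ : ℝ) : ℂ) with hF
  have hFc : ∀ i, Continuous (F i) := fun i => continuous_coord hcont _
  have hFp : ∀ i, Function.Periodic (F i) 1 := fun i => hγ.periodic_coord _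
  set a : ℤ → ℝ := fun k => ∑ i, ‖fourierCoeff (hFp i).lift k‖ ^ 2 with ha
  have hchord : ∀ u w, chord γ u w ^ 2 = ∑ i, ‖F i (u + w) - F i u‖ ^ 2 := by
    intro u w
    rw [chord, ← b.sum_sq_norm_inner_right]
    refine Finset.sum_congr rfl fun i _ => ?_
    rw [hF, ← Complex.ofReal_sub, ← inner_sub_right, Complex.norm_real]
  have hsum : ∀ w, HasSum (fun k : ℤ => 4 * Real.sin (k * (π * w)) ^ 2 * a k)
      (∫ u in Ioc (0:ℝ) 1, chord γ u w ^ 2) := by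
    intro w
    have h1 := hasSum_sum (s := Finset.univ) fun i _ => hasSum_sq_sub_shift (hFc i) (hFp i) w
    have h2 : ∫ u in Ioc (0:ℝ) 1, chord γ u w ^ 2 =
        ∑ i, ∫ u in (0:ℝ)..1, ‖F i (u + w) - F i u‖ ^ 2 := by
      simp only [hchord]
      rw [← intervalIntegral.integral_of_le zero_le_one, intervalIntegral.integral_finsetSum]
      intro i _
      have := hFc i
      exact Continuous.intervalIntegrable (by fun_prop) _ _
    rw [h2]
    simpa only [ha, Finset.mul_sum] using h1
  have hle : ∀ w ∈ Ioo (0:ℝ) 1, ∫ u in Ioc (0:ℝ) 1, chord γ u w ^ 2 ≤ w ^ 2 := by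
    intro w hw
    have h1 : ∫ u in Ioc (0:ℝ) 1, chord γ u w ^ 2 ≤ ∫ u in Ioc (0:ℝ) 1, w ^ 2 := by
      refine integral_mono_of_nonneg (ae_of_all _ fun u => sq_nonneg _) (integrable_const _)
        (ae_of_all _ fun u => ?_)
      exact pow_le_pow_left₀ (norm_nonneg _) (hγ.chord_le u hw.1.le) 2
    simpa using h1
  obtain ⟨h1, h2⟩ := chord_sq_bound_of_hasSum
    (fun k => Finset.sum_nonneg fun i _ => sq_nonneg ‖fourierCoeff (hFp i).lift k‖) hsum hle hw
  refine ⟨h1, fun heq => ?_⟩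
  have hz : ∀ i, ∀ k : ℤ, 2 ≤ k.natAbs → fourierCoeff (hFp i).lift k = 0 := by
    intro i k hk
    have h3 := (Finset.sum_eq_zero_iff_of_nonneg fun i _ => sq_nonneg _).1 (h2 heq k hk) i
      (Finset.mem_univ i)
    simpa using h3
  have htrig : ∀ t, γ t =
      (∑ i, (fourierCoeff (hFp i).lift 0).re • b i) + Real.cos (2 * π * t) •
        (∑ i, (fourierCoeff (hFp i).lift 1 + fourierCoeff (hFp i).lift (-1)).re • b i) +
      Real.sin (2 * π * t) • (∑ i, (Complex.I *
        (fourierCoeff (hFp i).lift 1 - fourierCoeff (hFp i).lift (-1))).re • b i) := by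
    intro t
    conv_lhs => rw [← b.sum_repr' (γ t)]
    rw [Finset.smul_sum, Finset.smul_sum, ← Finset.sum_add_distrib, ← Finset.sum_add_distrib]
    refine Finset.sum_congr rfl fun i _ => ?_
    have h3 := congrArg Complex.re (eq_trig_of_fourierCoeff_eq_zero (hFc i) (hFp i) (hz i) t)
    have e1 : Complex.cos (2 * π * t) = ((Real.cos (2 * π * t) : ℝ) : ℂ) := by push_cast; rfl
    have e2 : Complex.sin (2 * π * t) = ((Real.sin (2 * π * t) : ℝ) : ℂ) := by push_cast; rfl
    rw [e1, e2, Complex.add_re, Complex.add_re, Complex.re_ofReal_mul, Complex.re_ofReal_mul] at h3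
    have h4 : (F i t).re = ⟪b i, γ t⟫ := Complex.ofReal_re _
    rw [← h4, h3, add_smul, add_smul, mul_smul, mul_smul]
  exact hγ.isCircle_of_eq_trig htrig

end IsUnitLoop

end Loop

end FourierBound

section UnitSquare

open Filter Topology

/-- Lebesgue measure on the unit square. -/
def unitSquare : Measure (ℝ × ℝ) :=
  (volume.restrict (Ioc (0:ℝ) 1)).prod (volume.restrict (Ioc (0:ℝ) 1))

instance : IsFiniteMeasure unitSquare := by unfold unitSquare; infer_instance

lemma setLIntegral_add_right_of_periodic {f : ℝ → ℝ≥0∞} (hf : Function.Periodic f 1) (a : ℝ) :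
    ∫⁻ u in Ioc (0:ℝ) 1, f (u + a) = ∫⁻ u in Ioc (0:ℝ) 1, f u := by
  have h1 := (measurePreserving_add_right volume a).setLIntegral_comp_preimage_emb
    (MeasurableEquiv.addRight a).measurableEmbedding f (Ioc a (a + 1))
  have h2 : (fun x : ℝ => x + a) ⁻¹' Ioc a (a + 1) = Ioc 0 1 := by
    rw [preimage_add_const_Ioc]; simp
  rw [h2] at h1
  rw [h1]
  have h3 := (isAddFundamentalDomain_Ioc (zero_lt_one' ℝ) a).setLIntegral_eq
    (isAddFundamentalDomain_Ioc (zero_lt_one' ℝ) 0) f (by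
      rintro ⟨_, k, rfl⟩ x
      simpa [AddSubgroup.vadd_def, add_comm] using hf.zsmul k x)
  simpa using h3

lemma setLIntegral_one_sub (f : ℝ → ℝ≥0∞) :
    ∫⁻ w in Ioc (0:ℝ) 1, f (1 - w) = ∫⁻ w in Ioc (0:ℝ) 1, f w := by
  have h1 := (Measure.measurePreserving_sub_left volume (1:ℝ)).setLIntegral_comp_preimage_emb
    (MeasurableEquiv.subLeft (1:ℝ)).measurableEmbedding f (Ioo 0 1)
  have h2 : (fun x : ℝ => 1 - x) ⁻¹' Ioo 0 1 = Ioo 0 1 := by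
    rw [preimage_const_sub_Ioo]; simp
  rw [h2] at h1
  rwa [restrict_Ioo_eq_restrict_Ioc] at h1

lemma lintegral_unitSquare_reverse {F : ℝ × ℝ → ℝ≥0∞} (hF : Measurable F)
    (hper : ∀ u w, F (u + 1, w) = F (u, w)) :
    ∫⁻ z, F (z.1 + z.2, 1 - z.2) ∂unitSquare = ∫⁻ z, F z ∂unitSquare := by
  have hm : Measurable fun z : ℝ × ℝ => F (z.1 + z.2, 1 - z.2) := by fun_prop
  rw [unitSquare, lintegral_prod_symm _ hm.aemeasurable, lintegral_prod_symm _ hF.aemeasurable]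
  simp only
  calc _ = ∫⁻ w in Ioc (0:ℝ) 1, ∫⁻ u in Ioc (0:ℝ) 1, F (u, 1 - w) := by
        refine lintegral_congr fun w => ?_
        exact setLIntegral_add_right_of_periodic (f := fun u => F (u, 1 - w))
          (fun u => hper u _) w
    _ = _ := setLIntegral_one_sub fun w => ∫⁻ u in Ioc (0:ℝ) 1, F (u, w)

lemma ae_unitSquare_reverse {P : ℝ × ℝ → Prop} (hP : MeasurableSet {z | P z})
    (hper : ∀ u w, P (u + 1, w) ↔ P (u, w)) (h : ∀ᵐ z ∂unitSquare, P z) :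
    ∀ᵐ z ∂unitSquare, P (z.1 + z.2, 1 - z.2) := by
  classical
  have hm : Measurable ({z | P z}ᶜ.indicator (1 : ℝ × ℝ → ℝ≥0∞)) :=
    measurable_one.indicator hP.compl
  have h1 := lintegral_unitSquare_reverse hm (fun u w => by
    simp only [indicator_apply, mem_compl_iff, mem_ofPred_eq, hper, Pi.one_apply])
  have h2 : ∫⁻ z, {z | P z}ᶜ.indicator (1 : ℝ × ℝ → ℝ≥0∞) z ∂unitSquare = 0 := by
    rw [lintegral_indicator_one hP.compl]; exact h
  rw [h2, lintegral_eq_zero_iff (by fun_prop)] at h1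
  filter_upwards [h1] with z hz
  by_contra hcon
  simp [hcon] at hz

lemma ae_unitSquare_mem_Ioo : ∀ᵐ z ∂unitSquare, z.1 ∈ Ioo (0:ℝ) 1 ∧ z.2 ∈ Ioo (0:ℝ) 1 := by
  have h : ∀ᵐ w ∂volume.restrict (Ioc (0:ℝ) 1), w ∈ Ioo (0:ℝ) 1 := by
    rw [← restrict_Ioo_eq_restrict_Ioc]; exact ae_restrict_mem measurableSet_Ioo
  exact (Measure.quasiMeasurePreserving_fst.ae h).and (Measure.quasiMeasurePreserving_snd.ae h)

lemma integrable_of_lintegral_ofReal {α : Type*} [MeasurableSpace α] {μ : Measure α} {f : α → ℝ}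
    (hf : Measurable f) (h0 : ∀ x, 0 ≤ f x) {I : ℝ} (hI : 0 ≤ I)
    (h : ∫⁻ x, ENNReal.ofReal (f x) ∂μ = ENNReal.ofReal I) : Integrable f μ ∧ ∫ x, f x ∂μ = I := by
  have hi : Integrable f μ := ⟨hf.aestronglyMeasurable, by
    rw [hasFiniteIntegral_iff_ofReal (Eventually.of_forall h0), h]; exact ENNReal.ofReal_lt_top⟩
  refine ⟨hi, ?_⟩
  rw [integral_eq_lintegral_of_nonneg_ae (Eventually.of_forall h0) hf.aestronglyMeasurable, h,
    ENNReal.toReal_ofReal hI]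

namespace IsUnitLoop

variable {E : Type*} [NormedAddCommGroup E] [InnerProductSpace ℝ E]
variable {γ : ℝ → E} (hγ : IsUnitLoop γ)

include hγ

lemma reverse_sub (u w : ℝ) : γ (u + w + (1 - w)) - γ (u + w) = -(γ (u + w) - γ u) := by
  rw [show u + w + (1 - w) = u + 1 by ring, hγ.per u, neg_sub]

lemma chord_reverse (u w : ℝ) : chord γ (u + w) (1 - w) = chord γ u w := by
  rw [chord, hγ.reverse_sub, norm_neg, chord]

lemma sinL_reverse (u w : ℝ) : sinL γ (u + w) (1 - w) = sinR γ u w := by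
  rw [sinL, hγ.reverse_sub, InnerProductGeometry.angle_neg_right, Real.sin_pi_sub,
    InnerProductGeometry.angle_comm, sinR]

lemma sinR_reverse (u w : ℝ) : sinR γ (u + w) (1 - w) = sinL γ u w := by
  rw [sinR, hγ.reverse_sub, InnerProductGeometry.angle_neg_left, Real.sin_pi_sub,
    show u + w + (1 - w) = u + 1 by ring, hγ.deriv_periodic, InnerProductGeometry.angle_comm, sinL]

lemma chord_add_one (u w : ℝ) : chord γ (u + 1) w = chord γ u w := by
  rw [chord, chord, show u + 1 + w = u + w + 1 by ring, hγ.per, hγ.per]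

lemma sinL_add_one (u w : ℝ) : sinL γ (u + 1) w = sinL γ u w := by
  rw [sinL, sinL, show u + 1 + w = u + w + 1 by ring, hγ.per, hγ.per, hγ.deriv_periodic]

lemma sinR_add_one (u w : ℝ) : sinR γ (u + 1) w = sinR γ u w := by
  rw [sinR, sinR, show u + 1 + w = u + w + 1 by ring, hγ.per, hγ.per, hγ.deriv_periodic]

lemma ae_unitSquare_speed [FiniteDimensional ℝ E] [MeasurableSpace E] [BorelSpace E] :
    ∀ᵐ z ∂unitSquare, ‖deriv γ z.1‖ = 1 ∧ ‖deriv γ (z.1 + z.2)‖ = 1 := by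
  have hm : Measurable fun z : ℝ × ℝ => ‖deriv γ (z.1 + z.2)‖ :=
    ((measurable_deriv γ).comp (measurable_fst.add measurable_snd)).norm
  have h2 : ∀ᵐ z ∂unitSquare, ‖deriv γ (z.1 + z.2)‖ = 1 := by
    refine (Measure.ae_prod_iff_ae_ae (hm (measurableSet_singleton 1))).2 ?_
    refine Eventually.of_forall fun u => ae_restrict_of_ae ?_
    simpa only [add_comm, mem_singleton_iff] using hγ.ae_speed_add u
  exact (Measure.quasiMeasurePreserving_fst.ae (ae_restrict_of_ae hγ.speed)).and h2

lemma integrable_density [FiniteDimensional ℝ E] [MeasurableSpace E] [BorelSpace E]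
    {q s I : ℝ} (hI : 0 ≤ I)
    (hE : ∫⁻ z, ENNReal.ofReal (sinL γ z.1 z.2 ^ q * (π * chord γ z.1 z.2) ^ (-s)) ∂unitSquare
      = ENNReal.ofReal I) :
    (Integrable (fun z => sinL γ z.1 z.2 ^ q * (π * chord γ z.1 z.2) ^ (-s)) unitSquare ∧
      ∫ z, sinL γ z.1 z.2 ^ q * (π * chord γ z.1 z.2) ^ (-s) ∂unitSquare = I) ∧
    (Integrable (fun z => sinR γ z.1 z.2 ^ q * (π * chord γ z.1 z.2) ^ (-s)) unitSquare ∧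
      ∫ z, sinR γ z.1 z.2 ^ q * (π * chord γ z.1 z.2) ^ (-s) ∂unitSquare = I) := by
  have hc := hγ.lip.continuous
  have m0 := measurable_chord hc
  have m1 := measurable_sinL hc
  have m2 := measurable_sinR hc
  have n0 : ∀ z : ℝ × ℝ, 0 ≤ (π * chord γ z.1 z.2) ^ (-s) := fun z =>
    rpow_nonneg (mul_nonneg pi_pos.le (norm_nonneg _)) _
  have mA : Measurable fun z : ℝ × ℝ => sinL γ z.1 z.2 ^ q * (π * chord γ z.1 z.2) ^ (-s) :=
    (m1.pow_const q).mul ((m0.const_mul π).pow_const _)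
  have mB : Measurable fun z : ℝ × ℝ => sinR γ z.1 z.2 ^ q * (π * chord γ z.1 z.2) ^ (-s) :=
    (m2.pow_const q).mul ((m0.const_mul π).pow_const _)
  refine ⟨integrable_of_lintegral_ofReal mA
      (fun z => mul_nonneg (rpow_nonneg (sinL_nonneg _ _ _) _) (n0 z)) hI hE,
    integrable_of_lintegral_ofReal mB
      (fun z => mul_nonneg (rpow_nonneg (sinR_nonneg _ _ _) _) (n0 z)) hI ?_⟩
  rw [← hE, ← lintegral_unitSquare_reverse mA.ennreal_ofReal (fun u w => by
    simp only [hγ.sinL_add_one, hγ.chord_add_one])]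
  simp only [hγ.sinL_reverse, hγ.chord_reverse]

end IsUnitLoop

end UnitSquare

section ScalarInequalities

lemma rpow_le_one_add_half_mul {Y b : ℝ} (hY : 0 ≤ Y) (hb : 0 ≤ b) (hb2 : b ≤ 2) :
    Y ^ b ≤ 1 + b / 2 * (Y ^ 2 - 1) := by
  have h := Real.geom_mean_le_arith_mean2_weighted (by linarith : 0 ≤ b / 2)
    (by linarith : 0 ≤ 1 - b / 2) (sq_nonneg Y) zero_le_one (by ring)
  rw [Real.one_rpow, mul_one, ← Real.rpow_natCast, ← Real.rpow_mul hY] at h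
  rw [show ((2:ℕ):ℝ) * (b / 2) = b by push_cast; ring] at h
  rw [Real.rpow_natCast] at h
  linarith

lemma div_le_density_add {x y S q s : ℝ} (hx : 0 ≤ x) (hy : 0 < y) (hS : 0 < S) (hq : 1 < q)
    (hs : q ≤ s) (hs2 : s ≤ 3 * q - 2) :
    x / y ≤ 1 / q * (S ^ (s - q) * (x ^ q * y ^ (-s))) +
      (q - 1) / q * (1 + (s - q) / (q - 1) / 2 * ((y / S) ^ 2 - 1)) := by
  have hq0 : 0 < q := by linarith
  have hq1 : 0 < q - 1 := by linarith
  have hY : 0 < y / S := div_pos hy hS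
  have hX : 0 ≤ x / S := div_nonneg hx hS.le
  have h1 := rpow_le_one_add_half_mul hY.le (div_nonneg (by linarith : 0 ≤ s - q) hq1.le)
    (by rw [div_le_iff₀ hq1]; linarith)
  have h2 := Real.geom_mean_le_arith_mean2_weighted (by positivity : 0 ≤ 1 / q)
    (by positivity : 0 ≤ (q - 1) / q)
    (mul_nonneg (rpow_nonneg hX q) (rpow_nonneg hY.le (-s)))
    (rpow_nonneg hY.le ((s - q) / (q - 1))) (by field_simp; ring)
  rw [Real.mul_rpow (rpow_nonneg hX q) (rpow_nonneg hY.le (-s)), ← Real.rpow_mul hX,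
    ← Real.rpow_mul hY.le, ← Real.rpow_mul hY.le, mul_assoc, ← Real.rpow_add hY,
    mul_one_div_cancel hq0.ne', Real.rpow_one,
    show -s * (1 / q) + (s - q) / (q - 1) * ((q - 1) / q) = -1 by field_simp; ring,
    Real.rpow_neg_one] at h2
  have e1 : x / S * (y / S)⁻¹ = x / y := by field_simp
  have e2 : (x / S) ^ q * (y / S) ^ (-s) = S ^ (s - q) * (x ^ q * y ^ (-s)) := by
    rw [Real.div_rpow hx hS.le, Real.div_rpow hy.le hS.le, Real.rpow_sub hS, Real.rpow_neg hS.le s]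
    have := (rpow_pos_of_pos hS q).ne'
    have := (rpow_pos_of_pos hS s).ne'
    field_simp
  rw [e1, e2] at h2
  refine h2.trans ?_
  gcongr

lemma mul_density_le {x x' y c s q : ℝ} (hx : 0 ≤ x) (hx' : 0 ≤ x') (hy : 0 < y) (hq : 1 < q)
    (hc : 0 ≤ c) (hs : 1 ≤ s) (hcs : c + s = q) :
    x ^ c * (x' / y) ≤ c / q * (x ^ q * y ^ (-s)) + 1 / q * (x' ^ q * y ^ (-s)) +
      (s - 1) / q * y ^ c := by
  have hq0 : 0 < q := by linarith
  have hs1 : 0 ≤ s - 1 := by linarith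
  have h := Real.geom_mean_le_arith_mean3_weighted (by positivity : 0 ≤ c / q)
    (by positivity : 0 ≤ 1 / q) (by positivity : 0 ≤ (s - 1) / q)
    (mul_nonneg (rpow_nonneg hx q) (rpow_nonneg hy.le (-s)))
    (mul_nonneg (rpow_nonneg hx' q) (rpow_nonneg hy.le (-s))) (rpow_nonneg hy.le c)
    (by field_simp; linarith)
  refine le_of_eq_of_le ?_ h
  rw [Real.mul_rpow (rpow_nonneg hx q) (rpow_nonneg hy.le (-s)),
    Real.mul_rpow (rpow_nonneg hx' q) (rpow_nonneg hy.le (-s)), ← Real.rpow_mul hx,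
    ← Real.rpow_mul hx', ← Real.rpow_mul hy.le, ← Real.rpow_mul hy.le, ← Real.rpow_mul hy.le,
    mul_one_div_cancel hq0.ne', Real.rpow_one, mul_div_cancel₀ _ hq0.ne']
  have e : y ^ (-s * (c / q)) * y ^ (-s * (1 / q)) * y ^ (c * ((s - 1) / q)) = y⁻¹ := by
    rw [← Real.rpow_add hy, ← Real.rpow_add hy, ← Real.rpow_neg_one]
    congr 1
    field_simp
    linarith
  rw [div_eq_mul_inv, ← e]
  ring

lemma eq_one_of_young_eq {t q : ℝ} (ht : 0 ≤ t) (hq : 1 < q) (h : t = t ^ q / q + (q - 1) / q) :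
    t = 1 := by
  by_contra hne
  have := one_add_mul_self_lt_rpow_one_add (s := t - 1) (by linarith)
    (sub_ne_zero.2 hne) hq
  rw [add_sub_cancel] at this
  field_simp at h
  linarith

lemma eq_of_young_eq {x x' q : ℝ} (hx : 0 ≤ x) (hx' : 0 ≤ x') (hq : 1 < q)
    (h : x ^ (q - 1) * x' = (q - 1) / q * x ^ q + 1 / q * x' ^ q) : x' = x := by
  have hq0 : 0 < q := by linarith
  rcases hx.eq_or_lt with rfl | hx
  · rw [Real.zero_rpow (by linarith), Real.zero_rpow hq0.ne'] at h
    have : x' ^ q = 0 := by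
      have : 1 / q * x' ^ q = 0 := by linarith
      simpa [hq0.ne'] using this
    exact (Real.rpow_eq_zero hx' hq0.ne').1 this
  · have h1 := eq_one_of_young_eq (t := x' / x) (by positivity) hq (by
      rw [Real.div_rpow hx' hx.le]
      rw [Real.rpow_sub_one hx.ne'] at h
      have := rpow_pos_of_pos hx q
      field_simp at h ⊢
      linarith)
    field_simp at h1
    exact h1

end ScalarInequalities

section EnergyBounds

open Filter Topology InnerProductGeometry

variable {E : Type*} [NormedAddCommGroup E] [InnerProductSpace ℝ E]
  [FiniteDimensional ℝ E] [MeasurableSpace E] [BorelSpace E]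

namespace IsUnitLoop

variable {γ : ℝ → E} (hγ : IsUnitLoop γ)

include hγ

omit [FiniteDimensional ℝ E] [MeasurableSpace E] [BorelSpace E] in
lemma integrableOn_chord_sq (w : ℝ) :
    IntegrableOn (fun u => chord γ u w ^ 2) (Ioc 0 1) := by
  have hc := hγ.lip.continuous
  have : Continuous fun u => chord γ u w ^ 2 := by unfold chord; fun_prop
  exact this.integrableOn_Ioc

/-- Lower bound for the symmetrized energy density at a fixed parameter distance when the
exponents satisfy `q ≤ s`. -/
lemma rpow_sin_lt_integral_density {q s w : ℝ} (hq : 1 < q) (hqs : q < s) (hs : s ≤ 3 * q - 2)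
    (hw : w ∈ Ioo (0:ℝ) 1)
    (hH : ∫ u in Ioc (0:ℝ) 1, chord γ u w ^ 2 < Real.sin (π * w) ^ 2 / π ^ 2)
    (hA : IntegrableOn (fun u => sinL γ u w ^ q * (π * chord γ u w) ^ (-s)) (Ioc 0 1))
    (hB : IntegrableOn (fun u => sinR γ u w ^ q * (π * chord γ u w) ^ (-s)) (Ioc 0 1)) :
    Real.sin (π * w) ^ (q - s) < ∫ u in Ioc (0:ℝ) 1,
      (sinL γ u w ^ q * (π * chord γ u w) ^ (-s) +
        sinR γ u w ^ q * (π * chord γ u w) ^ (-s)) / 2 := by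
  have hq1 : 0 < q - 1 := by linarith
  have hS : 0 < Real.sin (π * w) :=
    Real.sin_pos_of_pos_of_lt_pi (by have := hw.1; positivity) (by nlinarith [hw.2, pi_pos])
  set S := Real.sin (π * w) with hSdef
  have hF := (hA.add hB).div_const 2
  simp only [Pi.add_apply] at hF
  set F := ∫ u in Ioc (0:ℝ) 1, (sinL γ u w ^ q * (π * chord γ u w) ^ (-s) +
        sinR γ u w ^ q * (π * chord γ u w) ^ (-s)) / 2 with hFdef
  have hR := hγ.integrableOn_chord_sq w
  set R := ∫ u in Ioc (0:ℝ) 1, chord γ u w ^ 2 with hRdef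
  set b := (s - q) / (q - 1) with hb
  have hb0 : 0 < b := div_pos (by linarith) hq1
  have hpt : ∀ u, (sinL γ u w + sinR γ u w) / chord γ u w ≤ (2 * π) * (1 / q * S ^ (s - q)) *
      ((sinL γ u w ^ q * (π * chord γ u w) ^ (-s) +
        sinR γ u w ^ q * (π * chord γ u w) ^ (-s)) / 2) +
      (2 * π * ((q - 1) / q * (1 - b / 2)) +
        2 * π * ((q - 1) / q * (b / 2) * (π ^ 2 / S ^ 2)) * chord γ u w ^ 2) := by
    intro u
    have hr := hγ.chord_pos u hw
    have hy : 0 < π * chord γ u w := mul_pos pi_pos hr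
    have h1 := div_le_density_add (sinL_nonneg γ u w) hy hS hq hqs.le hs
    have h2 := div_le_density_add (sinR_nonneg γ u w) hy hS hq hqs.le hs
    have h3 := mul_le_mul_of_nonneg_left (add_le_add h1 h2) pi_pos.le
    rw [← hb] at h3
    calc (sinL γ u w + sinR γ u w) / chord γ u w
        = π * (sinL γ u w / (π * chord γ u w) + sinR γ u w / (π * chord γ u w)) := by
          field_simp
      _ ≤ _ := h3
      _ = _ := by
          rw [div_pow, mul_pow]
          ring
  have hi1 := hF.const_mul ((2 * π) * (1 / q * S ^ (s - q)))
  have hi2 := hR.const_mul (2 * π * ((q - 1) / q * (b / 2) * (π ^ 2 / S ^ 2)))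
  have hi3 : IntegrableOn (fun _ : ℝ => 2 * π * ((q - 1) / q * (1 - b / 2))) (Ioc 0 1) := by
    exact integrableOn_const (by simp)
  have hi4 := hi3.integrable.add hi2
  simp only [Pi.add_def] at hi4
  have h4 := (hγ.two_pi_le_integral hw).trans (setIntegral_mono_on (hγ.integrableOn_sin_add_sin hw)
    (hi1.add hi4) measurableSet_Ioc fun u _ => hpt u)
  simp only [Pi.add_apply] at h4
  rw [integral_add hi1 hi4, integral_add hi3 hi2, setIntegral_const,
    MeasureTheory.integral_const_mul,
    MeasureTheory.integral_const_mul, ← hFdef,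
    ← hRdef] at h4
  simp only [Real.volume_real_Ioc,
    smul_eq_mul] at h4
  norm_num at h4
  have hlt : π ^ 2 / S ^ 2 * R < 1 := by
    rw [div_mul_eq_mul_div, div_lt_one (by positivity)]
    rw [lt_div_iff₀ (by positivity)] at hH
    linarith
  have hq0 : 0 < q := by linarith
  have h5 : 1 < S ^ (s - q) * F := by
    have h6 : 1 ≤ 1 / q * (S ^ (s - q) * F) + ((q - 1) / q * (1 - b / 2) +
        (q - 1) / q * (b / 2) * (π ^ 2 / S ^ 2 * R)) := by
      refine le_of_mul_le_mul_left ?_ (by positivity : 0 < 2 * π)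
      rw [mul_one]
      refine h4.trans (le_of_eq ?_)
      field_simp
    have h7 : (q - 1) / q * (b / 2) * (π ^ 2 / S ^ 2 * R) < (q - 1) / q * (b / 2) * 1 :=
      mul_lt_mul_of_pos_left hlt (by positivity)
    have h8 : (1:ℝ) / q * 1 < 1 / q * (S ^ (s - q) * F) := by
      have : (1:ℝ) / q = 1 - (q - 1) / q := by field_simp; ring
      rw [mul_one, this]
      rw [← this]
      linarith
    exact lt_of_mul_lt_mul_left h8 (by positivity)
  rw [show q - s = -(s - q) by ring, Real.rpow_neg hS.le,
    inv_lt_iff_one_lt_mul₀' (rpow_pos_of_pos hS _)]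
  exact h5

lemma false_of_energy_eq_of_lt {q s : ℝ} (hq : 1 < q) (hqs : q < s) (hs : s ≤ 3 * q - 2)
    (hE : ∫⁻ z, ENNReal.ofReal (sinL γ z.1 z.2 ^ q * (π * chord γ z.1 z.2) ^ (-s)) ∂unitSquare
      = ENNReal.ofReal (∫ w in Ioc (0:ℝ) 1, Real.sin (π * w) ^ (q - s)))
    (hH : ∀ w ∈ Ioo (0:ℝ) 1, ∫ u in Ioc (0:ℝ) 1, chord γ u w ^ 2 < Real.sin (π * w) ^ 2 / π ^ 2) :
    False := by
  have hS0 : ∀ w ∈ Ioc (0:ℝ) 1, 0 ≤ Real.sin (π * w) := fun w hw =>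
    Real.sin_nonneg_of_nonneg_of_le_pi (mul_nonneg pi_pos.le hw.1.le)
      (by nlinarith [hw.2, pi_pos])
  have hI : 0 ≤ ∫ w in Ioc (0:ℝ) 1, Real.sin (π * w) ^ (q - s) :=
    setIntegral_nonneg measurableSet_Ioc fun w hw => rpow_nonneg (hS0 w hw) _
  obtain ⟨⟨hA, hA'⟩, hB, hB'⟩ := hγ.integrable_density hI hE
  have hf := (hA.add hB).div_const 2
  have hf' : ∫ z, (sinL γ z.1 z.2 ^ q * (π * chord γ z.1 z.2) ^ (-s) +
      sinR γ z.1 z.2 ^ q * (π * chord γ z.1 z.2) ^ (-s)) / 2 ∂unitSquare =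
      ∫ w in Ioc (0:ℝ) 1, Real.sin (π * w) ^ (q - s) := by
    rw [MeasureTheory.integral_div, integral_add hA hB, hA', hB']
    ring
  simp only [Pi.add_apply] at hf
  unfold unitSquare at hf hf' hA hB
  rw [integral_prod_symm _ hf] at hf'
  have hlt : ∀ᵐ w ∂volume.restrict (Ioc (0:ℝ) 1), Real.sin (π * w) ^ (q - s) <
      ∫ u in Ioc (0:ℝ) 1, (sinL γ u w ^ q * (π * chord γ u w) ^ (-s) +
        sinR γ u w ^ q * (π * chord γ u w) ^ (-s)) / 2 := by
    have hmem : ∀ᵐ w ∂volume.restrict (Ioc (0:ℝ) 1), w ∈ Ioo (0:ℝ) 1 := by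
      rw [← restrict_Ioo_eq_restrict_Ioc]; exact ae_restrict_mem measurableSet_Ioo
    filter_upwards [hmem, hA.prod_left_ae, hB.prod_left_ae] with w hw h1 h2
    exact hγ.rpow_sin_lt_integral_density hq hqs hs hw (hH w hw) h1 h2
  have hSi : IntegrableOn (fun w => Real.sin (π * w) ^ (q - s)) (Ioc 0 1) := by
    refine hf.integral_prod_right.mono' ?_ ?_
    · exact (by fun_prop : Measurable fun w => Real.sin (π * w) ^ (q - s)).aestronglyMeasurable
    · filter_upwards [hlt, ae_restrict_mem measurableSet_Ioc] with w h1 h2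
      rw [Real.norm_of_nonneg (rpow_nonneg (hS0 w h2) _)]
      exact h1.le
  have heq := (integral_eq_iff_of_ae_le hSi hf.integral_prod_right
    (hlt.mono fun w h => h.le)).1 hf'.symm
  have hfalse : ∀ᵐ w ∂volume.restrict (Ioc (0:ℝ) 1), False := by
    filter_upwards [hlt, heq] with w h1 h2
    exact h1.ne h2
  rw [ae_iff] at hfalse
  simp at hfalse

end IsUnitLoop

end EnergyBounds

section EnergyEquality

open Filter Topology InnerProductGeometry

variable {E : Type*} [NormedAddCommGroup E] [InnerProductSpace ℝ E]
  [FiniteDimensional ℝ E] [MeasurableSpace E] [BorelSpace E]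

lemma ae_restrict_Ioc_mem_Ioo : ∀ᵐ w ∂volume.restrict (Ioc (0:ℝ) 1), w ∈ Ioo (0:ℝ) 1 := by
  rw [← restrict_Ioo_eq_restrict_Ioc]; exact ae_restrict_mem measurableSet_Ioo

lemma not_ae_restrict_Ioc_false : ¬ ∀ᵐ _w ∂volume.restrict (Ioc (0:ℝ) 1), False := by
  intro h
  rw [ae_iff] at h
  simp at h

lemma sin_pi_mul_pos {w : ℝ} (hw : w ∈ Ioo (0:ℝ) 1) : 0 < Real.sin (π * w) :=
  Real.sin_pos_of_pos_of_lt_pi (mul_pos pi_pos hw.1) (by nlinarith [hw.2, pi_pos])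

lemma integral_sin_pi_mul_rpow (c : ℝ) :
    ∫ w in Ioc (0:ℝ) 1, Real.sin (π * w) ^ c = π⁻¹ * ∫ z in (0:ℝ)..π, Real.sin z ^ c := by
  rw [← intervalIntegral.integral_of_le zero_le_one]
  have := intervalIntegral.integral_comp_mul_left (a := 0) (b := 1)
    (fun z => Real.sin z ^ c) pi_ne_zero
  simpa using this

lemma integrableOn_sin_pi_mul_rpow {c : ℝ} (hc : 0 ≤ c) :
    IntegrableOn (fun w => Real.sin (π * w) ^ c) (Ioc 0 1) := by
  have : Continuous fun w => Real.sin (π * w) ^ c :=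
    (by fun_prop : Continuous fun w => Real.sin (π * w)).rpow_const fun _ => Or.inr hc
  exact this.integrableOn_Ioc

namespace IsUnitLoop

variable {γ : ℝ → E} (hγ : IsUnitLoop γ)

include hγ

lemma integral_sin_rpow_le {u : ℝ} (hu : ‖deriv γ u‖ = 1) {c : ℝ} (hc : 0 ≤ c)
    (hint : IntegrableOn (fun w => sinL γ u w ^ c * (sinR γ u w / (π * chord γ u w))) (Ioc 0 1)) :
    (∫ w in Ioc (0:ℝ) 1, Real.sin (π * w) ^ c) ≤
      ∫ w in Ioc (0:ℝ) 1, sinL γ u w ^ c * (sinR γ u w / (π * chord γ u w)) ∧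
    ((∫ w in Ioc (0:ℝ) 1, Real.sin (π * w) ^ c) =
      ∫ w in Ioc (0:ℝ) 1, sinL γ u w ^ c * (sinR γ u w / (π * chord γ u w)) →
      ∀ᵐ w ∂volume.restrict (Ioc (0:ℝ) 1), sinL γ u w * sinR γ u w =
        -⟪deriv γ u, projPerp (γ (u + w) - γ u) (deriv γ (u + w))⟫) := by
  have hd : ∀ w, deriv (fun w => γ (u + w) - γ u) w = deriv γ (u + w) := fun w => by
    rw [deriv_sub_const, deriv_comp_const_add]
  have hu' := hasDerivAt_of_norm_deriv hu
  have hl : HasDerivAt (fun w => γ (u + w) - γ u) (deriv γ u) 0 := by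
    have h : HasDerivAt γ (deriv γ u) (u + 0) := by rwa [add_zero]
    exact (h.comp_const_add u 0).sub_const _
  have hr : HasDerivAt (fun w => γ (u + w) - γ u) (deriv γ u) 1 := by
    have h : HasDerivAt γ (deriv γ u) (u + 1) := by
      rw [← hγ.deriv_periodic u]
      exact hasDerivAt_of_norm_deriv (by rw [hγ.deriv_periodic u, hu])
    exact (h.comp_const_add u 1).sub_const _
  have hsp : ∀ᵐ w ∂volume.restrict (Ioc (0:ℝ) 1), ‖deriv γ (u + w)‖ = 1 := by
    refine ae_restrict_of_ae ?_
    simpa only [add_comm] using hγ.ae_speed_add u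
  have hp : ∀ᵐ w ∂volume.restrict (Ioc (0:ℝ) 1),
      ‖projPerp (γ (u + w) - γ u) (deriv γ (u + w))‖ = sinR γ u w := by
    filter_upwards [ae_restrict_Ioc_mem_Ioo, hsp] with w hw h1
    rw [norm_projPerp (hγ.sub_ne_zero u hw), h1, mul_one, sinR]
  have hcongr : (fun w => Real.sin (angle (deriv γ u) (γ (u + w) - γ u)) ^ c *
      (‖projPerp (γ (u + w) - γ u) (deriv (fun w => γ (u + w) - γ u) w)‖ / ‖γ (u + w) - γ u‖))
      =ᵐ[volume.restrict (Ioc (0:ℝ) 1)]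
      fun w => π * (sinL γ u w ^ c * (sinR γ u w / (π * chord γ u w))) := by
    filter_upwards [ae_restrict_Ioc_mem_Ioo, hp] with w hw h1
    have := (hγ.chord_pos u hw).ne'
    rw [hd, h1, ← sinL, ← chord]
    field_simp
  have h := angle_sweep hu (hγ.lipschitz_secant u) (fun w hw => hγ.sub_ne_zero u hw) hl
    (by simp) hr (by simp [hγ.per u]) hc ((hint.const_mul π).congr hcongr.symm)
  rw [integral_congr_ae hcongr, MeasureTheory.integral_const_mul] at h
  rw [integral_sin_pi_mul_rpow]
  refine ⟨?_, fun heq => ?_⟩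
  · rw [inv_mul_le_iff₀ pi_pos]
    exact h.1
  · rw [inv_mul_eq_iff_eq_mul₀ pi_ne_zero] at heq
    filter_upwards [ae_restrict_of_ae (h.2 heq), hp, ae_restrict_Ioc_mem_Ioo] with w h1 h2 hw
    have := h1 hw
    rwa [hd, h2, ← sinL] at this

omit [FiniteDimensional ℝ E] [MeasurableSpace E] [BorelSpace E] in
lemma integrable_chord_rpow {c : ℝ} (hc : 0 ≤ c) :
    Integrable (fun z => (π * chord γ z.1 z.2) ^ c) unitSquare := by
  have m0 := measurable_chord hγ.lip.continuous
  refine Integrable.of_bound ((m0.const_mul π).pow_const c).aestronglyMeasurable (π ^ c) ?_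
  filter_upwards [ae_unitSquare_mem_Ioo] with z hz
  have h0 : 0 ≤ π * chord γ z.1 z.2 := mul_nonneg pi_pos.le (norm_nonneg _)
  rw [Real.norm_of_nonneg (rpow_nonneg h0 c)]
  refine rpow_le_rpow h0 ?_ hc
  have := hγ.chord_le z.1 hz.2.1.le
  nlinarith [pi_pos, hz.2.2]

omit [FiniteDimensional ℝ E] [MeasurableSpace E] [BorelSpace E] in
lemma integral_chord_rpow_le {c : ℝ} (hc : 0 ≤ c) (hc2 : c ≤ 2)
    (hH : ∀ w ∈ Ioo (0:ℝ) 1, ∫ u in Ioc (0:ℝ) 1, chord γ u w ^ 2 < Real.sin (π * w) ^ 2 / π ^ 2) :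
    ∫ z, (π * chord γ z.1 z.2) ^ c ∂unitSquare ≤ ∫ w in Ioc (0:ℝ) 1, Real.sin (π * w) ^ c ∧
    (0 < c → ∫ z, (π * chord γ z.1 z.2) ^ c ∂unitSquare <
      ∫ w in Ioc (0:ℝ) 1, Real.sin (π * w) ^ c) := by
  have hi := hγ.integrable_chord_rpow hc
  have hSi := integrableOn_sin_pi_mul_rpow hc
  unfold unitSquare at hi ⊢
  rw [integral_prod_symm _ hi]
  have key : ∀ᵐ w ∂volume.restrict (Ioc (0:ℝ) 1),
      ∫ u in Ioc (0:ℝ) 1, (π * chord γ u w) ^ c ≤ Real.sin (π * w) ^ c ∧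
      (0 < c → ∫ u in Ioc (0:ℝ) 1, (π * chord γ u w) ^ c < Real.sin (π * w) ^ c) := by
    filter_upwards [ae_restrict_Ioc_mem_Ioo, hi.prod_left_ae] with w hw h1
    have hS := sin_pi_mul_pos hw
    set S := Real.sin (π * w)
    have hSc := rpow_pos_of_pos hS c
    have hpt : ∀ u, (π * chord γ u w) ^ c ≤ S ^ c * (1 - c / 2) +
        S ^ c * (c / 2) * (π ^ 2 / S ^ 2) * chord γ u w ^ 2 := fun u => by
      have hy : 0 ≤ π * chord γ u w := mul_nonneg pi_pos.le (norm_nonneg _)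
      have h2 := rpow_le_one_add_half_mul (div_nonneg hy hS.le) hc hc2
      rw [Real.div_rpow hy hS.le, div_le_iff₀' hSc] at h2
      refine h2.trans (le_of_eq ?_)
      rw [div_pow, mul_pow]
      ring
    have hR := hγ.integrableOn_chord_sq w
    have hi1 := hR.const_mul (S ^ c * (c / 2) * (π ^ 2 / S ^ 2))
    have hi2 : IntegrableOn (fun _ : ℝ => S ^ c * (1 - c / 2)) (Ioc 0 1) :=
      integrableOn_const (by simp)
    have h3 := setIntegral_mono_on (g := fun u => S ^ c * (1 - c / 2) +
        S ^ c * (c / 2) * (π ^ 2 / S ^ 2) * chord γ u w ^ 2) h1 (hi2.add hi1)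
        measurableSet_Ioc fun u _ => hpt u
    rw [integral_add hi2 hi1, setIntegral_const, MeasureTheory.integral_const_mul] at h3
    simp only [Real.volume_real_Ioc, smul_eq_mul] at h3
    norm_num at h3
    have hlt : π ^ 2 / S ^ 2 * ∫ u in Ioc (0:ℝ) 1, chord γ u w ^ 2 < 1 := by
      have := hH w hw
      rw [div_mul_eq_mul_div, div_lt_one (by positivity)]
      rw [lt_div_iff₀ (by positivity)] at this
      linarith
    have h4 : ∫ u in Ioc (0:ℝ) 1, (π * chord γ u w) ^ c ≤ S ^ c * (1 - c / 2) +
        S ^ c * (c / 2) * (π ^ 2 / S ^ 2 * ∫ u in Ioc (0:ℝ) 1, chord γ u w ^ 2) := by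
      rw [← mul_assoc]; exact h3
    refine ⟨?_, fun hc0 => ?_⟩
    · have := mul_le_mul_of_nonneg_left hlt.le (by positivity : 0 ≤ S ^ c * (c / 2))
      linarith
    · have := mul_lt_mul_of_pos_left hlt (by positivity : 0 < S ^ c * (c / 2))
      linarith
  have hle := integral_mono_ae hi.integral_prod_right hSi (key.mono fun w h => h.1)
  refine ⟨hle, fun hc0 => hle.lt_of_ne fun heq => ?_⟩
  have := (integral_eq_iff_of_ae_le hi.integral_prod_right hSi (key.mono fun w h => h.1)).1 heq
  refine not_ae_restrict_Ioc_false ?_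
  filter_upwards [key, this] with w h1 h2
  exact (h1.2 hc0).ne h2

end IsUnitLoop

end EnergyEquality

section EnergyRigidity

open Filter Topology InnerProductGeometry

variable {E : Type*} [NormedAddCommGroup E] [InnerProductSpace ℝ E]
  [FiniteDimensional ℝ E] [MeasurableSpace E] [BorelSpace E]

namespace IsUnitLoop

variable {γ : ℝ → E} (hγ : IsUnitLoop γ)

include hγ

lemma ae_young_eq_of_energy_eq {c s q : ℝ} (hq : 1 < q) (hc : 0 ≤ c) (hs : 1 ≤ s)
    (hcs : c + s = q) (hc2 : s = 1 ∨ c ≤ 2)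
    (hE : ∫⁻ z, ENNReal.ofReal (sinL γ z.1 z.2 ^ q * (π * chord γ z.1 z.2) ^ (-s)) ∂unitSquare
      = ENNReal.ofReal (∫ w in Ioc (0:ℝ) 1, Real.sin (π * w) ^ c))
    (hH : ∀ w ∈ Ioo (0:ℝ) 1, ∫ u in Ioc (0:ℝ) 1, chord γ u w ^ 2 < Real.sin (π * w) ^ 2 / π ^ 2) :
    (s = 1 ∨ c = 0) ∧
    (∀ᵐ z ∂unitSquare, sinL γ z.1 z.2 ^ c * (sinR γ z.1 z.2 / (π * chord γ z.1 z.2)) =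
      c / q * (sinL γ z.1 z.2 ^ q * (π * chord γ z.1 z.2) ^ (-s)) +
      1 / q * (sinR γ z.1 z.2 ^ q * (π * chord γ z.1 z.2) ^ (-s)) +
      (s - 1) / q * (π * chord γ z.1 z.2) ^ c) ∧
    ∀ᵐ u ∂volume.restrict (Ioc (0:ℝ) 1), ∀ᵐ w ∂volume.restrict (Ioc (0:ℝ) 1),
      sinL γ u w * sinR γ u w =
        -⟪deriv γ u, projPerp (γ (u + w) - γ u) (deriv γ (u + w))⟫ := by
  have hq0 : 0 < q := by linarith
  set I := ∫ w in Ioc (0:ℝ) 1, Real.sin (π * w) ^ c with hIdef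
  have hI : 0 ≤ I := setIntegral_nonneg measurableSet_Ioc fun w hw => rpow_nonneg
    (Real.sin_nonneg_of_nonneg_of_le_pi (mul_nonneg pi_pos.le hw.1.le)
      (by nlinarith [hw.2, pi_pos])) _
  obtain ⟨⟨hA, hA'⟩, hB, hB'⟩ := hγ.integrable_density hI hE
  have hJ := hγ.integrable_chord_rpow hc
  have hAB := (hA.const_mul (c / q)).add (hB.const_mul (1 / q))
  simp only [Pi.add_def] at hAB
  have hR := hAB.add (hJ.const_mul ((s - 1) / q))
  have hRint : ∫ z, (c / q * (sinL γ z.1 z.2 ^ q * (π * chord γ z.1 z.2) ^ (-s)) +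
      1 / q * (sinR γ z.1 z.2 ^ q * (π * chord γ z.1 z.2) ^ (-s)) +
      (s - 1) / q * (π * chord γ z.1 z.2) ^ c) ∂unitSquare =
      (c + 1) / q * I + (s - 1) / q * ∫ z, (π * chord γ z.1 z.2) ^ c ∂unitSquare := by
    rw [integral_add hAB (hJ.const_mul ((s - 1) / q)),
      integral_add (hA.const_mul (c / q)) (hB.const_mul (1 / q)),
      MeasureTheory.integral_const_mul, MeasureTheory.integral_const_mul,
      MeasureTheory.integral_const_mul, hA', hB']
    ring
  have hRint_le : (c + 1) / q * I + (s - 1) / q * ∫ z, (π * chord γ z.1 z.2) ^ c ∂unitSquare ≤ I ∧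
      (1 < s → 0 < c → (c + 1) / q * I +
        (s - 1) / q * ∫ z, (π * chord γ z.1 z.2) ^ c ∂unitSquare < I) := by
    have e : I = (c + 1) / q * I + (s - 1) / q * I := by
      rw [← add_mul, ← add_div, show c + 1 + (s - 1) = q by linarith, div_self hq0.ne', one_mul]
    rcases hc2 with rfl | hc2
    · refine ⟨?_, fun h => absurd h (lt_irrefl _)⟩
      nth_rw 2 [e]
      simp
    · obtain ⟨h1, h2⟩ := hγ.integral_chord_rpow_le hc hc2 hH
      refine ⟨?_, fun hs1 hc0 => ?_⟩
      · have := mul_le_mul_of_nonneg_left h1 (div_nonneg (sub_nonneg.2 hs) hq0.le)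
        linarith
      · have := mul_lt_mul_of_pos_left (h2 hc0) (div_pos (sub_pos.2 hs1) hq0)
        linarith
  have m0 := measurable_chord hγ.lip.continuous
  have m1 := measurable_sinL hγ.lip.continuous
  have m2 := measurable_sinR hγ.lip.continuous
  have hle : ∀ᵐ z ∂unitSquare, sinL γ z.1 z.2 ^ c * (sinR γ z.1 z.2 / (π * chord γ z.1 z.2)) ≤
      c / q * (sinL γ z.1 z.2 ^ q * (π * chord γ z.1 z.2) ^ (-s)) +
      1 / q * (sinR γ z.1 z.2 ^ q * (π * chord γ z.1 z.2) ^ (-s)) +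
      (s - 1) / q * (π * chord γ z.1 z.2) ^ c := by
    filter_upwards [ae_unitSquare_mem_Ioo] with z hz
    exact mul_density_le (sinL_nonneg _ _ _) (sinR_nonneg _ _ _)
      (mul_pos pi_pos (hγ.chord_pos z.1 hz.2)) hq hc hs hcs
  have h0 : ∀ z : ℝ × ℝ, 0 ≤ sinL γ z.1 z.2 ^ c * (sinR γ z.1 z.2 / (π * chord γ z.1 z.2)) :=
    fun z => mul_nonneg (rpow_nonneg (sinL_nonneg _ _ _) _)
      (div_nonneg (sinR_nonneg _ _ _) (mul_nonneg pi_pos.le (norm_nonneg _)))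
  have hBi : Integrable
      (fun z => sinL γ z.1 z.2 ^ c * (sinR γ z.1 z.2 / (π * chord γ z.1 z.2))) unitSquare := by
    refine hR.mono' ((m1.pow_const c).mul (m2.div (m0.const_mul π))).aestronglyMeasurable ?_
    filter_upwards [hle] with z hz
    rw [Real.norm_of_nonneg (h0 z)]
    exact hz
  have hle' := integral_mono_ae hBi hR hle
  simp only [Pi.add_apply] at hle'
  rw [hRint] at hle'
  have hBi2 := hBi
  unfold unitSquare at hBi2
  have hIi : Integrable (fun _ : ℝ => I) (volume.restrict (Ioc (0:ℝ) 1)) := integrable_const I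
  have hsl : ∀ᵐ u ∂volume.restrict (Ioc (0:ℝ) 1), I ≤
      ∫ w in Ioc (0:ℝ) 1, sinL γ u w ^ c * (sinR γ u w / (π * chord γ u w)) := by
    filter_upwards [hBi2.prod_right_ae, ae_restrict_of_ae hγ.speed] with u h1 h2
    exact (hγ.integral_sin_rpow_le h2 hc h1).1
  have hIint : ∫ _ in Ioc (0:ℝ) 1, I = I := by simp
  have hBprod : ∫ z, sinL γ z.1 z.2 ^ c * (sinR γ z.1 z.2 / (π * chord γ z.1 z.2)) ∂unitSquare =
      ∫ u in Ioc (0:ℝ) 1, ∫ w in Ioc (0:ℝ) 1,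
        sinL γ u w ^ c * (sinR γ u w / (π * chord γ u w)) := by
    unfold unitSquare
    rw [integral_prod _ hBi2]
  have hge := integral_mono_ae hIi hBi2.integral_prod_left hsl
  simp only at hge
  rw [hIint, ← hBprod] at hge
  refine ⟨?_, ?_, ?_⟩
  · by_contra! hcon
    have := hRint_le.2 (hs.lt_of_ne hcon.1.symm) (hc.lt_of_ne hcon.2.symm)
    linarith
  · refine (integral_eq_iff_of_ae_le hBi hR hle).1 ?_
    simp only [Pi.add_apply]
    rw [hRint]
    linarith [hRint_le.1]
  · have heq := (integral_eq_iff_of_ae_le hIi hBi2.integral_prod_left hsl).1 (by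
      rw [hIint]
      simp only
      rw [← hBprod]
      linarith [hRint_le.1])
    filter_upwards [hBi2.prod_right_ae, ae_restrict_of_ae hγ.speed, heq] with u h1 h2 h3
    exact (hγ.integral_sin_rpow_le h2 hc h1).2 h3

lemma ae_sinL_eq_sinR_of_energy_eq {c s q : ℝ} (hq : 1 < q) (hc : 0 ≤ c) (hs : 1 ≤ s)
    (hcs : c + s = q) (hc2 : s = 1 ∨ c ≤ 2)
    (hE : ∫⁻ z, ENNReal.ofReal (sinL γ z.1 z.2 ^ q * (π * chord γ z.1 z.2) ^ (-s)) ∂unitSquare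
      = ENNReal.ofReal (∫ w in Ioc (0:ℝ) 1, Real.sin (π * w) ^ c))
    (hH : ∀ w ∈ Ioo (0:ℝ) 1, ∫ u in Ioc (0:ℝ) 1, chord γ u w ^ 2 < Real.sin (π * w) ^ 2 / π ^ 2) :
    ∀ᵐ z ∂unitSquare, sinL γ z.1 z.2 = sinR γ z.1 z.2 := by
  have hq0 : 0 < q := by linarith
  obtain ⟨h1, h2, -⟩ := hγ.ae_young_eq_of_energy_eq hq hc hs hcs hc2 hE hH
  rcases h1 with rfl | rfl
  · filter_upwards [h2, ae_unitSquare_mem_Ioo] with z hz hz2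
    have hr := (hγ.chord_pos z.1 hz2.2).ne'
    refine (eq_of_young_eq (sinL_nonneg _ _ _) (sinR_nonneg _ _ _) hq ?_).symm
    rw [show q - 1 = c by linarith]
    rw [Real.rpow_neg_one, sub_self, zero_div, zero_mul, add_zero] at hz
    field_simp at hz ⊢
    linarith
  · have hs' : s = q := by linarith
    subst hs'
    have h3 : ∀ᵐ z ∂unitSquare, sinR γ z.1 z.2 = π * chord γ z.1 z.2 := by
      filter_upwards [h2, ae_unitSquare_mem_Ioo] with z hz hz2
      have hy := mul_pos pi_pos (hγ.chord_pos z.1 hz2.2)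
      have hR := sinR_nonneg γ z.1 z.2
      have h4 := eq_one_of_young_eq (t := sinR γ z.1 z.2 / (π * chord γ z.1 z.2))
        (by positivity) hq (by
          rw [Real.rpow_zero, Real.rpow_zero, Real.rpow_neg hy.le] at hz
          rw [Real.div_rpow hR hy.le]
          linear_combination hz)
      rwa [div_eq_one_iff_eq hy.ne'] at h4
    have h4 := ae_unitSquare_reverse (P := fun z => sinR γ z.1 z.2 = π * chord γ z.1 z.2)
      (measurableSet_eq_fun (measurable_sinR hγ.lip.continuous)
        ((measurable_chord hγ.lip.continuous).const_mul π))
      (fun u w => by simp only [hγ.sinR_add_one, hγ.chord_add_one]) h3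
    filter_upwards [h3, h4] with z h5 h6
    simp only [hγ.sinR_reverse, hγ.chord_reverse] at h6
    rw [h5, h6]

end IsUnitLoop

end EnergyRigidity

section RealAnalysis

open Filter Topology

lemma countable_zeros_of_deriv_ne_zero (f : ℝ → ℝ) :
    {x | f x = 0 ∧ ∃ f', f' ≠ 0 ∧ HasDerivAt f f' x}.Countable := by
  refine Countable.mono ?_ (countable_setOfPred_isolated_right_within
    (s := {x | f x = 0 ∧ ∃ f', f' ≠ 0 ∧ HasDerivAt f f' x}))
  intro x hx
  refine And.intro hx ?_
  obtain ⟨-, f', h0, hf⟩ := hx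
  have h := hf.eventually_ne (c := 0) h0
  rw [← Filter.eventually_false_iff_eq_bot]
  have h1 : ∀ᶠ z in 𝓝[{x | f x = 0 ∧ ∃ f', f' ≠ 0 ∧ HasDerivAt f f' x} ∩ Ioi x] x, f z ≠ 0 :=
    h.filter_mono (nhdsWithin_mono _ fun z hz => ne_of_gt hz.2)
  filter_upwards [h1, self_mem_nhdsWithin] with z hz hz2
  exact hz hz2.1.1

lemma hasDerivAt_of_ae_deriv_eq {f g : ℝ → ℝ} {K : NNReal} (hf : LipschitzWith K f) {a b : ℝ}
    (hg : ContinuousOn g (Ioo a b)) (h : ∀ᵐ t, t ∈ Ioo a b → deriv f t = g t) {t : ℝ}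
    (ht : t ∈ Ioo a b) : HasDerivAt f (g t) t := by
  obtain ⟨a', ha', ha't⟩ := exists_between ht.1
  obtain ⟨b', hb't, hb'⟩ := exists_between ht.2
  have hsub : Icc a' b' ⊆ Ioo a b := fun x hx => ⟨ha'.trans_le hx.1, hx.2.trans_lt hb'⟩
  have hF : ∀ x ∈ Icc a' b', f x = f a' + ∫ y in a'..x, g y := by
    intro x hx
    have h1 := (hf.lipschitzOnWith (s := uIcc a' x)).absolutelyContinuousOnInterval
      |>.integral_deriv_eq_sub
    rw [← intervalIntegral.integral_congr_ae (f := deriv f), h1]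
    · ring
    · filter_upwards [h] with y hy hy2
      rw [uIoc_of_le hx.1] at hy2
      exact hy (hsub ⟨hy2.1.le, hy2.2.trans hx.2⟩)
  have hgc : ContinuousOn g (Icc a' b') := hg.mono hsub
  have hi : IntervalIntegrable g volume a' t :=
    (hgc.mono (by rw [uIcc_of_le ha't.le]; exact Icc_subset_Icc_right hb't.le)).intervalIntegrable
  have hct : ContinuousAt g t := hg.continuousAt (Ioo_mem_nhds ht.1 ht.2)
  have hmeas : StronglyMeasurableAtFilter g (𝓝 t) :=
    hg.stronglyMeasurableAtFilter isOpen_Ioo t ht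
  have hd := (intervalIntegral.integral_hasDerivAt_right hi hmeas hct).const_add (f a')
  refine hd.congr_of_eventuallyEq ?_
  filter_upwards [Icc_mem_nhds ha't hb't] with x hx using hF x hx

lemma ae_of_ae_Ioc_of_periodic {p : ℝ → Prop} (hp : ∀ t, p (t + 1) ↔ p t)
    (h : ∀ᵐ t ∂volume.restrict (Ioc (0:ℝ) 1), p t) : ∀ᵐ t, p t := by
  rw [ae_restrict_iff' measurableSet_Ioc] at h
  have hpn : ∀ (n : ℤ) t, p (t + n) ↔ p t := fun n t => by
    have hper : Function.Periodic p 1 := fun t => propext (hp t)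
    have := hper.zsmul n t
    rw [zsmul_one] at this
    exact iff_of_eq this
  have h2 : ∀ n : ℤ, ∀ᵐ t, t ∈ Ioc (n:ℝ) (n + 1) → p t := fun n => by
    have := (measurePreserving_add_right volume (-(n:ℝ))).quasiMeasurePreserving.ae h
    filter_upwards [this] with t ht hmem
    have h3 := ht ⟨by linarith [hmem.1], by linarith [hmem.2]⟩
    have h4 := hpn n (t + -(n:ℝ))
    rw [neg_add_cancel_right] at h4
    exact h4.2 h3
  filter_upwards [ae_all_iff.2 h2] with t ht
  have : t ∈ ⋃ n : ℤ, Ioc (n:ℝ) (n + 1) := by rw [iUnion_Ioc_intCast]; trivial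
  obtain ⟨n, hn⟩ := mem_iUnion.1 this
  exact ht n hn

end RealAnalysis

section PairRelation

open Filter Topology InnerProductGeometry

variable {E : Type*} [NormedAddCommGroup E] [InnerProductSpace ℝ E]

lemma sin_angle_sq (v x : E) (hv : ‖v‖ = 1) :
    Real.sin (angle v x) ^ 2 = 1 - ⟪x, v⟫ ^ 2 / ‖x‖ ^ 2 := by
  rw [Real.sin_sq, cos_angle, hv, one_mul, div_pow, real_inner_comm]

/-- The relation between tangents and chord satisfied by almost all pairs of points of an
extremal curve. -/
def TangentRelation (γ : ℝ → E) (u v : ℝ) : Prop :=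
  ⟪γ v - γ u, deriv γ u⟫ ^ 2 = ⟪γ v - γ u, deriv γ v⟫ ^ 2 ∧
    ⟪deriv γ u, deriv γ v⟫ * ‖γ v - γ u‖ ^ 2 =
      ⟪γ v - γ u, deriv γ u⟫ * ⟪γ v - γ u, deriv γ v⟫ - ‖γ v - γ u‖ ^ 2 +
        ⟪γ v - γ u, deriv γ u⟫ ^ 2

namespace IsUnitLoop

variable {γ : ℝ → E} (hγ : IsUnitLoop γ)

include hγ

lemma tangentRelation {u w : ℝ} (hw : w ∈ Ioo (0:ℝ) 1) (hu : ‖deriv γ u‖ = 1)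
    (hv : ‖deriv γ (u + w)‖ = 1) (h1 : sinL γ u w = sinR γ u w)
    (h2 : sinL γ u w * sinR γ u w =
      -⟪deriv γ u, projPerp (γ (u + w) - γ u) (deriv γ (u + w))⟫) :
    TangentRelation γ u (u + w) := by
  have h0 := hγ.sub_ne_zero u hw
  have hR : ‖γ (u + w) - γ u‖ ^ 2 ≠ 0 := by simpa using h0
  have e1 : sinL γ u w ^ 2 =
      1 - ⟪γ (u + w) - γ u, deriv γ u⟫ ^ 2 / ‖γ (u + w) - γ u‖ ^ 2 := sin_angle_sq _ _ hu
  have e2 : sinR γ u w ^ 2 =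
      1 - ⟪γ (u + w) - γ u, deriv γ (u + w)⟫ ^ 2 / ‖γ (u + w) - γ u‖ ^ 2 := by
    rw [sinR, angle_comm]
    exact sin_angle_sq _ _ hv
  have h3 : sinL γ u w ^ 2 = sinR γ u w ^ 2 := by rw [h1]
  rw [← h1, ← sq, e1, projPerp, inner_sub_right, real_inner_smul_right,
    real_inner_comm (γ (u + w) - γ u) (deriv γ u)] at h2
  rw [e1, e2] at h3
  unfold TangentRelation
  constructor
  · field_simp at h3
    linarith
  · field_simp at h2
    linarith

lemma tangentRelation_add_one_left (u v : ℝ) :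
    TangentRelation γ (u + 1) v ↔ TangentRelation γ u v := by
  unfold TangentRelation
  rw [hγ.per, hγ.deriv_periodic]

lemma tangentRelation_add_one_right (u v : ℝ) :
    TangentRelation γ u (v + 1) ↔ TangentRelation γ u v := by
  unfold TangentRelation
  rw [hγ.per, hγ.deriv_periodic]

variable [FiniteDimensional ℝ E] [MeasurableSpace E] [BorelSpace E]

omit [FiniteDimensional ℝ E] in
lemma measurableSet_tangentRelation [CompleteSpace E] [SecondCountableTopology E] :
    MeasurableSet {z : ℝ × ℝ | TangentRelation γ z.1 z.2} := by
  have hc := hγ.lip.continuous.measurable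
  have hd := measurable_deriv γ
  unfold TangentRelation
  refine (measurableSet_eq_fun ?_ ?_).inter (measurableSet_eq_fun ?_ ?_) <;> fun_prop

lemma ae_tangentRelation (h1 : ∀ᵐ z ∂unitSquare, sinL γ z.1 z.2 = sinR γ z.1 z.2)
    (h2 : ∀ᵐ u ∂volume.restrict (Ioc (0:ℝ) 1), ∀ᵐ w ∂volume.restrict (Ioc (0:ℝ) 1),
      sinL γ u w * sinR γ u w =
        -⟪deriv γ u, projPerp (γ (u + w) - γ u) (deriv γ (u + w))⟫) :
    (∀ᵐ u, ∀ᵐ v, TangentRelation γ u v) ∧ ∀ᵐ v, ∀ᵐ u, TangentRelation γ u v := by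
  have hfirst : ∀ᵐ u, ∀ᵐ v, TangentRelation γ u v := by
    refine ae_of_ae_Ioc_of_periodic (fun t => by simp only [hγ.tangentRelation_add_one_left]) ?_
    filter_upwards [Measure.ae_ae_of_ae_prod h1, h2,
      Measure.ae_ae_of_ae_prod hγ.ae_unitSquare_speed] with u k1 k2 k3
    have : ∀ᵐ w, TangentRelation γ u (u + w) := by
      refine ae_of_ae_Ioc_of_periodic (fun t => by
        rw [← add_assoc, hγ.tangentRelation_add_one_right]) ?_
      filter_upwards [k1, k2, k3, ae_restrict_Ioc_mem_Ioo] with w l1 l2 l3 hw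
      exact hγ.tangentRelation hw l3.1 l3.2 l1 l2
    have := (measurePreserving_add_right volume (-u)).quasiMeasurePreserving.ae this
    simpa using this
  exact ⟨hfirst, (Measure.ae_ae_comm hγ.measurableSet_tangentRelation).1 hfirst⟩

end IsUnitLoop

end PairRelation

section TangentODE

lemma eq_of_hasDerivAt_zero {f : ℝ → ℝ} {a b : ℝ} (hab : a ≤ b) (hf : ContinuousOn f (Icc a b))
    (h : ∀ x ∈ Ioo a b, HasDerivAt f 0 x) : f b = f a := by
  rcases hab.eq_or_lt with rfl | hab
  · rfl
  obtain ⟨c, -, hc⟩ := exists_hasDerivAt_eq_slope f (fun _ => 0) hab hf h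
  rw [eq_comm, div_eq_zero_iff] at hc
  rcases hc with hc | hc <;> linarith

lemma eqOn_of_hasDerivAt_zero {f : ℝ → ℝ} (hf : ContinuousOn f (Icc 0 1))
    (h : ∀ x ∈ Ioo (0:ℝ) 1, HasDerivAt f 0 x) {w : ℝ} (hw : w ∈ Icc (0:ℝ) 1) : f w = f 0 :=
  eq_of_hasDerivAt_zero hw.1 (hf.mono (Icc_subset_Icc_right hw.2))
    fun x hx => h x ⟨hx.1, hx.2.trans_le hw.2⟩

lemma eq_pi_of_sin_eq_zero {κ : ℝ} (hκ : 0 < κ) (h1 : Real.sin κ = 0)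
    (h : ∀ w ∈ Ioo (0:ℝ) 1, Real.sin (κ * w) ≠ 0) : κ = π := by
  rcases lt_trichotomy κ π with hlt | heq | hgt
  · exact absurd h1 (sin_pos_of_pos_of_lt_pi hκ hlt).ne'
  · exact heq
  · have := h (π / κ) ⟨by positivity, (div_lt_one hκ).2 hgt⟩
    rw [mul_div_cancel₀ _ hκ.ne', sin_pi] at this
    exact absurd rfl this

variable {R N : ℝ → ℝ}

/-- The system satisfied by the squared chord length and the tangential component of the chord
of an extremal curve has only the solution belonging to the circle. -/
lemma eq_sin_sq_of_ode (hRc : ContinuousOn R (Icc 0 1)) (hNc : ContinuousOn N (Icc 0 1))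
    (hR : ∀ w ∈ Ioo (0:ℝ) 1, HasDerivAt R (2 * N w) w)
    (hN : ∀ w ∈ Ioo (0:ℝ) 1, HasDerivAt N (2 * N w ^ 2 / R w - 1) w)
    (hpos : ∀ w ∈ Ioo (0:ℝ) 1, 0 < R w) (hle : ∀ w ∈ Ioo (0:ℝ) 1, N w ^ 2 ≤ R w)
    (hR0 : R 0 = 0) (hR1 : R 1 = 0) (hN0 : N 0 = 0) {w : ℝ} (hw : w ∈ Ioo (0:ℝ) 1) :
    R w = Real.sin (π * w) ^ 2 / π ^ 2 := by
  have hKd : ∀ w ∈ Ioo (0:ℝ) 1, HasDerivAt (fun w => (R w - N w ^ 2) / R w ^ 2) 0 w := by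
    intro w hw
    have hp := (hpos w hw).ne'
    refine (((hR w hw).fun_sub ((hN w hw).fun_pow 2)).fun_div ((hR w hw).fun_pow 2)
      (pow_ne_zero 2 hp)).congr_deriv ?_
    field_simp
    ring
  have hKc : ∀ w ∈ Ioo (0:ℝ) 1, (R w - N w ^ 2) / R w ^ 2 =
      (R (1 / 2) - N (1 / 2) ^ 2) / R (1 / 2) ^ 2 := by
    intro w hw
    rcases le_total w (1 / 2) with h | h
    · have hs : Icc w (1 / 2) ⊆ Ioo (0:ℝ) 1 := fun x hx =>
        ⟨hw.1.trans_le hx.1, hx.2.trans_lt (by norm_num)⟩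
      exact (eq_of_hasDerivAt_zero h (fun x hx => (hKd x (hs hx)).continuousAt.continuousWithinAt)
        fun x hx => hKd x (hs (Ioo_subset_Icc_self hx))).symm
    · have hs : Icc (1 / 2) w ⊆ Ioo (0:ℝ) 1 := fun x hx =>
        ⟨lt_of_lt_of_le (by norm_num) hx.1, hx.2.trans_lt hw.2⟩
      exact eq_of_hasDerivAt_zero h (fun x hx => (hKd x (hs hx)).continuousAt.continuousWithinAt)
        fun x hx => hKd x (hs (Ioo_subset_Icc_self hx))
  have hhalf : (1 / 2 : ℝ) ∈ Ioo (0:ℝ) 1 := by constructor <;> norm_num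
  have hK0 : 0 ≤ (R (1 / 2) - N (1 / 2) ^ 2) / R (1 / 2) ^ 2 :=
    div_nonneg (sub_nonneg.2 (hle _ hhalf)) (sq_nonneg _)
  obtain ⟨κ, hκ0, hκ⟩ : ∃ κ : ℝ, 0 ≤ κ ∧ κ ^ 2 = (R (1 / 2) - N (1 / 2) ^ 2) / R (1 / 2) ^ 2 :=
    ⟨_, Real.sqrt_nonneg _, Real.sq_sqrt hK0⟩
  rw [← hκ] at hKc
  have hN' : ∀ w ∈ Ioo (0:ℝ) 1, HasDerivAt N (1 - 2 * κ ^ 2 * R w) w := by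
    intro w hw
    convert hN w hw using 1
    have hp := (hpos w hw).ne'
    have := hKc w hw
    field_simp at this ⊢
    linarith
  rcases hκ0.eq_or_lt with rfl | hκpos
  · have hNw : ∀ w ∈ Icc (0:ℝ) 1, N w = w := by
      intro w hw
      have := eqOn_of_hasDerivAt_zero (f := fun w => N w - w) (hNc.sub continuousOn_id)
        (fun x hx => by simpa using (hN' x hx).fun_sub (hasDerivAt_id' x)) hw
      simp only [hN0] at this
      linarith
    have := eqOn_of_hasDerivAt_zero (f := fun w => R w - w ^ 2) (w := 1)
      (hRc.sub (continuousOn_id.pow 2)) (fun x hx => by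
        simpa [hNw x (Ioo_subset_Icc_self hx)] using
          (hR x hx).fun_sub ((hasDerivAt_id' x).fun_pow 2))
      (by simp)
    simp [hR0, hR1] at this
  · have hlin : ∀ x : ℝ, HasDerivAt (fun w : ℝ => κ * w) κ x := fun x => by
      simpa using (hasDerivAt_id x).const_mul κ
    have hs : ∀ x, HasDerivAt (fun w => Real.sin (κ * w)) (Real.cos (κ * x) * κ) x :=
      fun x => (hlin x).sin
    have hc : ∀ x, HasDerivAt (fun w => Real.cos (κ * w)) (-Real.sin (κ * x) * κ) x :=
      fun x => (hlin x).cos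
    have hform : ∀ w ∈ Icc (0:ℝ) 1, R w = Real.sin (κ * w) ^ 2 / κ ^ 2 := by
      intro w hw
      have := eqOn_of_hasDerivAt_zero
        (f := fun w => κ ^ 2 * (R w - Real.sin (κ * w) ^ 2 / κ ^ 2) ^ 2 +
          (N w - Real.sin (κ * w) * Real.cos (κ * w) / κ) ^ 2) (by fun_prop) (fun x hx => by
        refine (((((hR x hx).fun_sub (((hs x).fun_pow 2).div_const (κ ^ 2))).fun_pow 2).const_mul
          (κ ^ 2)).fun_add
            (((hN' x hx).fun_sub (((hs x).fun_mul (hc x)).div_const κ)).fun_pow 2)).congr_deriv ?_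
        have h1 : (Real.cos (κ * x) * κ * Real.cos (κ * x) +
            Real.sin (κ * x) * (-Real.sin (κ * x) * κ)) / κ = 1 - 2 * Real.sin (κ * x) ^ 2 := by
          field_simp
          linarith [Real.sin_sq_add_cos_sq (κ * x)]
        rw [h1]
        ring_nf
        field_simp
        ring) hw
      simp only [hR0, hN0, mul_zero, Real.sin_zero] at this
      have h1 : κ ^ 2 * (R w - Real.sin (κ * w) ^ 2 / κ ^ 2) ^ 2 = 0 := by
        have a1 := sq_nonneg (N w - Real.sin (κ * w) * Real.cos (κ * w) / κ)
        have a2 : 0 ≤ κ ^ 2 * (R w - Real.sin (κ * w) ^ 2 / κ ^ 2) ^ 2 := by positivity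
        norm_num at this
        linarith
      have h2 := (mul_eq_zero.1 h1).resolve_left (by positivity)
      have := pow_eq_zero_iff (two_ne_zero) |>.1 h2
      linarith
    have hκπ : κ = π := by
      refine eq_pi_of_sin_eq_zero hκpos ?_ fun w hw h0 => ?_
      · have := hform 1 (by simp)
        rw [hR1, mul_one, eq_comm, div_eq_zero_iff] at this
        exact pow_eq_zero_iff two_ne_zero |>.1 (this.resolve_right (by positivity))
      · have := hform w (Ioo_subset_Icc_self hw)
        rw [h0] at this
        have h3 := hpos w hw
        simp [this] at h3
    rw [hform w (Ioo_subset_Icc_self hw), hκπ]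

end TangentODE

section PairRigidity

open Filter Topology

variable {E : Type*} [NormedAddCommGroup E] [InnerProductSpace ℝ E]

namespace IsUnitLoop

variable {γ : ℝ → E} (hγ : IsUnitLoop γ)

include hγ

lemma lipschitz_inner (c a : E) : LipschitzWith ‖a‖₊ fun t => ⟪γ t - c, a⟫ := by
  refine LipschitzWith.of_dist_le_mul fun x y => ?_
  rw [Real.dist_eq, ← inner_sub_left, sub_sub_sub_cancel_right]
  refine (abs_real_inner_le_norm _ _).trans ?_
  have := hγ.lip.dist_le_mul x y
  rw [dist_eq_norm, NNReal.coe_one, one_mul] at this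
  rw [mul_comm]
  exact mul_le_mul_of_nonneg_left this (norm_nonneg a)

omit hγ in
lemma hasDerivAt_inner_sub {γ : ℝ → E} {τ : E} {t : ℝ} (h : HasDerivAt γ τ t) (c a : E) :
    HasDerivAt (fun t => ⟪γ t - c, a⟫) ⟪τ, a⟫ t := by
  simpa using (h.sub_const c).inner ℝ (hasDerivAt_const t a)

/-- An injective loop is not contained in a line. -/
lemma exists_sub_ne_smul (e : E) : ∃ t, γ t - γ 0 ≠ ⟪γ t - γ 0, e⟫ • e := by
  by_contra! h
  have hc : Continuous fun t => ⟪γ t - γ 0, e⟫ := (hγ.lipschitz_inner _ _).continuous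
  obtain ⟨t, -, ht⟩ : ∃ t ∈ Icc (0:ℝ) (1 / 2),
      ⟪γ (t + 1 / 2) - γ 0, e⟫ - ⟪γ t - γ 0, e⟫ = 0 := by
    have hk : Continuous fun t => ⟪γ (t + 1 / 2) - γ 0, e⟫ - ⟪γ t - γ 0, e⟫ :=
      (hc.comp (continuous_add_const (1 / 2))).sub hc
    have h2 : γ (1 / 2 + 1 / 2) = γ 0 := by
      have := hγ.per 0
      norm_num at this ⊢
      exact this
    rcases le_total 0 ⟪γ (1 / 2) - γ 0, e⟫ with h0 | h0
    · exact intermediate_value_Icc' (by norm_num) hk.continuousOn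
          ⟨by rw [h2]; simpa using h0, by simpa using h0⟩
    · exact intermediate_value_Icc (by norm_num) hk.continuousOn
          ⟨by simpa using h0, by rw [h2]; simpa using h0⟩
  have heq : γ (t + 1 / 2) = γ t := by
    have h1 := h (t + 1 / 2)
    rw [sub_eq_zero.1 ht, ← h t] at h1
    exact sub_left_injective h1
  exact hγ.sub_ne_zero t (w := 1 / 2) (by constructor <;> norm_num) (sub_eq_zero.2 heq)

lemma not_ae_deriv_parallel {e : E} (he : ‖e‖ = 1) :
    ¬ ∀ᵐ t, deriv γ t = e ∨ deriv γ t = -e := by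
  intro h
  obtain ⟨t, ht⟩ := hγ.exists_sub_ne_smul e
  refine ht ?_
  set a := γ t - γ 0 - ⟪γ t - γ 0, e⟫ • e with ha
  have hae : ⟪e, a⟫ = 0 := by
    rw [ha, inner_sub_right, real_inner_smul_right, real_inner_self_eq_norm_sq, he,
      real_inner_comm]
    ring
  have hd : ∀ s, HasDerivAt (fun t => ⟪γ t - γ 0, a⟫) 0 s := fun s => by
    refine hasDerivAt_of_ae_deriv_eq (g := fun _ => 0) (hγ.lipschitz_inner _ _)
      (a := s - 1) (b := s + 1) continuousOn_const ?_ ⟨by linarith, by linarith⟩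
    filter_upwards [h, hγ.speed] with r hr hs _
    rw [(hasDerivAt_inner_sub (hasDerivAt_of_norm_deriv hs) _ _).deriv]
    rcases hr with hr | hr <;> simp [hr, hae]
  have hconst := is_const_of_deriv_eq_zero (fun s => (hd s).differentiableAt)
    (fun s => (hd s).deriv) t 0
  simp only [sub_self, inner_zero_left] at hconst
  have : ⟪a, a⟫ = 0 := by
    nth_rewrite 1 [ha]
    rw [inner_sub_left, hconst, real_inner_smul_left, hae, mul_zero, sub_zero]
  exact sub_eq_zero.1 (inner_self_eq_zero.1 this)

lemma ae_deriv_ne (h : ∀ᵐ v, ∀ᵐ u, TangentRelation γ u v) {e : E} (he : ‖e‖ = 1) :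
    ∀ᵐ u, deriv γ u ≠ e := by
  by_contra hT
  refine hγ.not_ae_deriv_parallel he ?_
  filter_upwards [h, hγ.speed] with v hv hs
  by_contra! hne
  refine hT ?_
  have hnull : ∀ a : E, ⟪e, a⟫ ≠ 0 → ∀ᵐ u, deriv γ u = e → ⟪γ u - γ v, a⟫ ≠ 0 := by
    intro a ha
    refine measure_mono_null ?_
      ((countable_zeros_of_deriv_ne_zero fun u => ⟪γ u - γ v, a⟫).measure_zero volume)
    intro u hu
    simp only [ne_eq, Classical.not_imp, not_not, mem_compl_iff, mem_ofPred_eq] at hu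
    have := hasDerivAt_of_norm_deriv (u := u) (by rw [hu.1, he])
    rw [hu.1] at this
    exact ⟨hu.2, _, ha, hasDerivAt_inner_sub this _ _⟩
  have h1 := hnull (e - deriv γ v) (by
    rw [inner_sub_right, real_inner_self_eq_norm_sq, he, one_pow, _root_.sub_ne_zero]
    exact fun h0 => hne.1 ((inner_eq_one_iff_of_norm_eq_one he hs).1 h0.symm).symm)
  have h2 := hnull (e + deriv γ v) (by
    rw [inner_add_right, real_inner_self_eq_norm_sq, he, one_pow]
    intro h0
    have := (inner_eq_neg_one_iff_of_norm_eq_one (𝕜 := ℝ) he hs).1 (by linarith)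
    exact hne.2 (by rw [this, neg_neg]))
  filter_upwards [hv, h1, h2] with u hu k1 k2 hue
  have k1 := k1 hue
  have k2 := k2 hue
  rw [inner_sub_right] at k1
  rw [inner_add_right] at k2
  have h3 := hu.1
  rw [hue, ← neg_sub, inner_neg_left, inner_neg_left] at h3
  exact mul_ne_zero k1 k2 (by linarith)

lemma ae_tangent_eq (h1 : ∀ᵐ u, ∀ᵐ v, TangentRelation γ u v)
    (h2 : ∀ᵐ v, ∀ᵐ u, TangentRelation γ u v) : ∀ᵐ u, ‖deriv γ u‖ = 1 ∧
      ∀ᵐ v, ‖deriv γ v‖ = 1 ∧ ⟪γ v - γ u, deriv γ u⟫ = ⟪γ v - γ u, deriv γ v⟫ ∧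
        ⟪deriv γ u, deriv γ v⟫ * ‖γ v - γ u‖ ^ 2 =
          2 * ⟪γ v - γ u, deriv γ u⟫ ^ 2 - ‖γ v - γ u‖ ^ 2 := by
  filter_upwards [h1, hγ.speed] with u hu hs
  refine ⟨hs, ?_⟩
  have hne := hγ.ae_deriv_ne h2 (e := -deriv γ u) (by rw [norm_neg, hs])
  filter_upwards [hu, hne, hγ.speed] with v hv hvne hvs
  have hN : ⟪γ v - γ u, deriv γ u⟫ = ⟪γ v - γ u, deriv γ v⟫ := by
    by_cases h0 : γ v - γ u = 0
    · simp [h0]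
    refine (sq_eq_sq_iff_eq_or_eq_neg.1 hv.1).resolve_right fun hneg => hvne ?_
    have h3 := hv.2
    rw [hneg] at h3
    have hR : ‖γ v - γ u‖ ^ 2 ≠ 0 := by simpa using h0
    have h4 : ⟪deriv γ u, deriv γ v⟫ = -1 := by
      refine mul_right_cancel₀ hR ?_
      rw [h3]
      ring
    rw [(inner_eq_neg_one_iff_of_norm_eq_one hs hvs).1 h4, neg_neg]
  refine ⟨hvs, hN, ?_⟩
  rw [hv.2, ← hN]
  ring

lemma chord_sq_eq {u : ℝ} (hu : ‖deriv γ u‖ = 1)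
    (h : ∀ᵐ v, ‖deriv γ v‖ = 1 ∧ ⟪γ v - γ u, deriv γ u⟫ = ⟪γ v - γ u, deriv γ v⟫ ∧
      ⟪deriv γ u, deriv γ v⟫ * ‖γ v - γ u‖ ^ 2 =
        2 * ⟪γ v - γ u, deriv γ u⟫ ^ 2 - ‖γ v - γ u‖ ^ 2) {w : ℝ} (hw : w ∈ Ioo (0:ℝ) 1) :
    chord γ u w ^ 2 = Real.sin (π * w) ^ 2 / π ^ 2 := by
  have hc := hγ.lip.continuous
  have h' := (measurePreserving_add_left volume u).quasiMeasurePreserving.ae h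
  set N : ℝ → ℝ := fun w => ⟪γ (u + w) - γ u, deriv γ u⟫ with hNdef
  have hNc : Continuous N := by fun_prop
  have hrc : Continuous fun w => chord γ u w := by unfold chord; fun_prop
  have hγd : ∀ {w}, ‖deriv γ (u + w)‖ = 1 →
      HasDerivAt (fun w => γ (u + w) - γ u) (deriv γ (u + w)) w := fun {w} hs =>
    ((hasDerivAt_of_norm_deriv hs).comp_const_add u w).sub_const _
  have hr : ∀ w ∈ Ioo (0:ℝ) 1, HasDerivAt (fun w => chord γ u w) (N w / chord γ u w) w := by
    intro w hw
    refine hasDerivAt_of_ae_deriv_eq (f := fun w => chord γ u w)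
      (g := fun w => N w / chord γ u w) (K := 1 * 1)
      ((lipschitzWith_one_norm (E := E)).comp (hγ.lipschitz_secant u))
      (hNc.continuousOn.div hrc.continuousOn fun x hx => (hγ.chord_pos u hx).ne') ?_ hw
    filter_upwards [h'] with x hx hmem
    have hp := hγ.chord_pos u hmem
    have hd := (hγd hx.1).norm_sq.sqrt (pow_ne_zero 2 hp.ne')
    simp only [Real.sqrt_sq (norm_nonneg _)] at hd
    rw [← hx.2.1] at hd
    have := hd.deriv
    simp only [chord]
    rw [this]
    simp only [hNdef]
    ring
  have hN : ∀ w ∈ Ioo (0:ℝ) 1, HasDerivAt N (2 * N w ^ 2 / chord γ u w ^ 2 - 1) w := by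
    intro w hw
    have hlip : LipschitzWith ‖deriv γ u‖₊ N := by
      have := (hγ.lipschitz_inner (γ u) (deriv γ u)).comp (LipschitzWith.of_dist_le_mul
        (K := 1) (f := fun w => u + w) fun x y => by simp)
      rwa [mul_one] at this
    refine hasDerivAt_of_ae_deriv_eq (g := fun w => 2 * N w ^ 2 / chord γ u w ^ 2 - 1) hlip
      (((continuousOn_const.mul (hNc.continuousOn.pow 2)).div (hrc.continuousOn.pow 2)
        fun x hx => pow_ne_zero 2 (hγ.chord_pos u hx).ne').sub continuousOn_const) ?_ hw
    filter_upwards [h'] with x hx hmem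
    have hp := hγ.chord_pos u hmem
    have hd := (hγd hx.1).inner ℝ (hasDerivAt_const x (deriv γ u))
    rw [inner_zero_right, zero_add] at hd
    rw [hd.deriv]
    have h3 := hx.2.2
    rw [real_inner_comm, eq_sub_iff_add_eq]
    rw [eq_div_iff (by positivity)]
    simp only [hNdef, chord]
    linarith
  refine eq_sin_sq_of_ode (R := fun w => chord γ u w ^ 2) (N := N) (hrc.pow 2).continuousOn
    hNc.continuousOn ?_ hN (fun x hx => pow_pos (hγ.chord_pos u hx) 2) ?_ ?_ ?_ ?_ hw
  · intro x hx
    refine ((hr x hx).fun_pow 2).congr_deriv ?_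
    have := (hγ.chord_pos u hx).ne'
    field_simp
    norm_num
    ring
  · intro x _
    have := abs_real_inner_le_norm (γ (u + x) - γ u) (deriv γ u)
    rw [hu, mul_one] at this
    rw [← sq_abs]
    exact pow_le_pow_left₀ (abs_nonneg _) this 2
  · simp [chord]
  · simp [chord, hγ.per u]
  · simp [hNdef]

end IsUnitLoop

end PairRigidity

section UnitLoopRigidity

variable {E : Type*} [NormedAddCommGroup E] [InnerProductSpace ℝ E]
  [FiniteDimensional ℝ E] [MeasurableSpace E] [BorelSpace E]

theorem IsUnitLoop.isCircle_of_energy_eq {γ : ℝ → E} (hγ : IsUnitLoop γ) {q s : ℝ} (hq : 1 < q)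
    (hs1 : 1 ≤ s) (hs3 : s ≤ 3 * q - 2) (hs : s = 1 ∨ q - s ≤ 2)
    (hE : ∫⁻ z, ENNReal.ofReal (sinL γ z.1 z.2 ^ q * (π * chord γ z.1 z.2) ^ (-s)) ∂unitSquare
      = ENNReal.ofReal (∫ w in Ioc (0:ℝ) 1, Real.sin (π * w) ^ (q - s))) :
    IsCircle (range γ) := by
  by_contra hcirc
  have hH : ∀ w ∈ Ioo (0:ℝ) 1,
      ∫ u in Ioc (0:ℝ) 1, chord γ u w ^ 2 < Real.sin (π * w) ^ 2 / π ^ 2 := fun w hw =>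
    lt_of_not_ge fun h => hcirc ((hγ.integral_chord_sq hw).2 h)
  rcases lt_or_ge q s with hqs | hqs
  · exact hγ.false_of_energy_eq_of_lt hq hqs hs3 hE hH
  have hc : 0 ≤ q - s := sub_nonneg.2 hqs
  have hrel := hγ.ae_tangentRelation
    (hγ.ae_sinL_eq_sinR_of_energy_eq hq hc hs1 (sub_add_cancel q s) hs hE hH)
    (hγ.ae_young_eq_of_energy_eq hq hc hs1 (sub_add_cancel q s) hs hE hH).2.2
  have hw : (1 / 2 : ℝ) ∈ Ioo (0:ℝ) 1 := by constructor <;> norm_num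
  refine (hH _ hw).ne ?_
  rw [setIntegral_congr_ae (g := fun _ => Real.sin (π * (1 / 2)) ^ 2 / π ^ 2) measurableSet_Ioc]
  · simp
  · filter_upwards [hγ.ae_tangent_eq hrel.1 hrel.2] with u hu _
    exact hγ.chord_sq_eq hu.1 hu.2 hw

end UnitLoopRigidity

section UnitDensity

open Filter Topology

/-- A periodic density which is positive almost everywhere and has total mass one on a period. -/
structure IsUnitDensity (f : ℝ → ℝ) : Prop where
  nonneg : ∀ t, 0 ≤ f t
  per : Function.Periodic f 1
  pos : ∀ᵐ t, 0 < f t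
  int : LocallyIntegrable f
  mass : ∫ t in (0:ℝ)..1, f t = 1

lemma locallyIntegrable_of_periodic {F : Type*} [NormedAddCommGroup F] {f : ℝ → F}
    (hf : Function.Periodic f 1) (h : IntegrableOn f (Icc 0 1)) : LocallyIntegrable f := by
  intro x
  have hi : IntervalIntegrable f volume 0 1 :=
    (intervalIntegrable_iff_integrableOn_Icc_of_le zero_le_one).2 h
  exact ⟨Icc (x - 1) (x + 1), Icc_mem_nhds (by linarith) (by linarith),
    (intervalIntegrable_iff_integrableOn_Icc_of_le (by linarith)).1
      (hf.intervalIntegrable₀ one_ne_zero hi _ _)⟩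

namespace IsUnitDensity

variable {f : ℝ → ℝ} (hf : IsUnitDensity f)

include hf

lemma intervalIntegrable (a b : ℝ) : IntervalIntegrable f volume a b :=
  intervalIntegrable_iff.2 ((hf.int.integrableOn_isCompact isCompact_uIcc).mono_set
    uIoc_subset_uIcc)

lemma primitive_sub (a b : ℝ) :
    (∫ t in (0:ℝ)..b, f t) - ∫ t in (0:ℝ)..a, f t = ∫ t in a..b, f t :=
  integral_interval_sub_left (hf.intervalIntegrable _ _) (hf.intervalIntegrable _ _)

lemma continuous_primitive : Continuous fun x => ∫ t in (0:ℝ)..x, f t :=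
  intervalIntegral.continuous_primitive hf.intervalIntegrable 0

lemma strictMono_primitive : StrictMono fun x => ∫ t in (0:ℝ)..x, f t := by
  intro a b hab
  have : 0 < ∫ t in a..b, f t := by
    rw [integral_of_le hab.le, setIntegral_pos_iff_support_of_nonneg_ae
      (Eventually.of_forall hf.nonneg) (hf.intervalIntegrable a b).1]
    have h1 : volume (Function.support f ∩ Ioc a b) = volume (Ioc a b) := by
      refine measure_congr (inter_ae_eq_right_of_ae_eq_univ (eventuallyEq_univ.2 ?_))
      filter_upwards [hf.pos] with t ht using ht.ne'
    rw [h1]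
    simpa using hab
  have h2 := hf.primitive_sub a b
  simp only
  linarith

lemma primitive_add_one (x : ℝ) :
    ∫ t in (0:ℝ)..(x + 1), f t = (∫ t in (0:ℝ)..x, f t) + 1 := by
  have h1 := hf.primitive_sub x (x + 1)
  rw [hf.per.intervalIntegral_add_eq x 0, zero_add, hf.mass] at h1
  linarith

lemma primitive_add_int (x : ℝ) (k : ℤ) :
    ∫ t in (0:ℝ)..(x + k), f t = (∫ t in (0:ℝ)..x, f t) + k := by
  have hper : Function.Periodic (fun x : ℝ => (∫ t in (0:ℝ)..x, f t) - x) 1 := fun x => by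
    simp only [hf.primitive_add_one]
    ring
  have := hper.zsmul k x
  simp only [zsmul_one] at this
  linarith

lemma primitive_int (k : ℤ) : ∫ t in (0:ℝ)..k, f t = k := by
  simpa using hf.primitive_add_int 0 k

lemma surjective_primitive : Function.Surjective fun x => ∫ t in (0:ℝ)..x, f t := by
  intro y
  have h := intermediate_value_Icc (a := (⌊y⌋ : ℝ)) (b := ((⌊y⌋ + 1 : ℤ) : ℝ)) (by simp)
    hf.continuous_primitive.continuousOn
  rw [hf.primitive_int, hf.primitive_int] at h
  obtain ⟨x, -, hx⟩ := h ⟨Int.floor_le y, by push_cast; exact (Int.lt_floor_add_one y).le⟩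
  exact ⟨x, hx⟩

/-- The reparametrization of the line given by a unit density. -/
def reparam : ℝ ≃o ℝ :=
  hf.strictMono_primitive.orderIsoOfSurjective _ hf.surjective_primitive

lemma reparam_apply (x : ℝ) : hf.reparam x = ∫ t in (0:ℝ)..x, f t := rfl

lemma reparam_zero : hf.reparam 0 = 0 := by simp [reparam_apply]

lemma reparam_one : hf.reparam 1 = 1 := by simp [reparam_apply, hf.mass]

lemma reparam_add_one (x : ℝ) : hf.reparam (x + 1) = hf.reparam x + 1 := hf.primitive_add_one x

lemma reparam_add_int (x : ℝ) (k : ℤ) : hf.reparam (x + k) = hf.reparam x + k :=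
  hf.primitive_add_int x k

lemma reparam_symm_add_one (x : ℝ) : hf.reparam.symm (x + 1) = hf.reparam.symm x + 1 := by
  rw [OrderIso.symm_apply_eq, hf.reparam_add_one, OrderIso.apply_symm_apply]

lemma measurable_reparam : Measurable hf.reparam := hf.reparam.continuous.measurable

lemma ae_hasDerivAt_reparam : ∀ᵐ t, HasDerivAt hf.reparam (f t) t := by
  filter_upwards [LocallyIntegrable.ae_hasDerivAt_integral hf.int] with t ht using ht 0

lemma aemeasurable_ofReal : AEMeasurable (fun t => ENNReal.ofReal (f t)) :=
  hf.int.aestronglyMeasurable.aemeasurable.ennreal_ofReal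

lemma map_withDensity :
    (volume.withDensity fun t => ENNReal.ofReal (f t)).map hf.reparam = volume := by
  symm
  refine Real.measure_ext_Ioo_rat fun a b => ?_
  rw [Measure.map_apply hf.measurable_reparam measurableSet_Ioo, OrderIso.preimage_Ioo,
    withDensity_apply _ measurableSet_Ioo, Real.volume_Ioo]
  rcases le_total (a:ℝ) b with hab | hab
  · have h1 : hf.reparam.symm a ≤ hf.reparam.symm b := hf.reparam.symm.monotone hab
    rw [restrict_Ioo_eq_restrict_Ioc, ← ofReal_integral_eq_lintegral_ofReal
      (hf.intervalIntegrable _ _).1 (Eventually.of_forall hf.nonneg), ← integral_of_le h1,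
      ← hf.primitive_sub, ← hf.reparam_apply, ← hf.reparam_apply]
    simp
  · rw [Ioo_eq_empty (not_lt.2 (hf.reparam.symm.monotone hab)),
      ENNReal.ofReal_of_nonpos (by linarith)]
    simp

lemma setLIntegral_comp_reparam {g : ℝ → ℝ≥0∞} (hg : Measurable g) :
    ∫⁻ t in Ioc (0:ℝ) 1, ENNReal.ofReal (f t) * g (hf.reparam t) = ∫⁻ x in Ioc (0:ℝ) 1, g x := by
  conv_rhs => rw [← hf.map_withDensity]
  rw [setLIntegral_map measurableSet_Ioc hg hf.measurable_reparam]
  have hpre : hf.reparam ⁻¹' Ioc 0 1 = Ioc 0 1 := by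
    rw [OrderIso.preimage_Ioc, hf.reparam.symm_apply_eq.2 hf.reparam_zero.symm,
      hf.reparam.symm_apply_eq.2 hf.reparam_one.symm]
  rw [hpre, restrict_withDensity measurableSet_Ioc, lintegral_withDensity_eq_lintegral_mul₀
    hf.aemeasurable_ofReal.restrict (g := fun t => g (hf.reparam t))
    (hg.comp hf.measurable_reparam).aemeasurable]
  rfl

lemma ae_of_ae_comp_reparam {p : ℝ → Prop} (hp : MeasurableSet {x | p x})
    (h : ∀ᵐ t, p (hf.reparam t)) : ∀ᵐ x, p x := by
  rw [← hf.map_withDensity, ae_map_iff hf.measurable_reparam.aemeasurable hp]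
  exact withDensity_absolutelyContinuous _ _ h

end IsUnitDensity

end UnitDensity

section ArclengthReparametrization

open Filter Topology InnerProductGeometry

namespace ClosedCurve

variable {n : ℕ} (γ : ClosedCurve n)

lemma locallyIntegrable_deriv : LocallyIntegrable γ.deriv' :=
  locallyIntegrable_of_periodic γ.deriv'_periodic γ.integrableOn

lemma intervalIntegrable_deriv (a b : ℝ) : IntervalIntegrable γ.deriv' volume a b :=
  intervalIntegrable_iff.2 ((γ.locallyIntegrable_deriv.integrableOn_isCompact
    isCompact_uIcc).mono_set uIoc_subset_uIcc)

lemma sub_eq_integral (a b : ℝ) : γ.toFun b - γ.toFun a = ∫ t in a..b, γ.deriv' t := by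
  rw [γ.eq_integral b, γ.eq_integral a, add_sub_add_left_eq_sub,
    integral_interval_sub_left (γ.intervalIntegrable_deriv _ _) (γ.intervalIntegrable_deriv _ _)]

lemma ae_hasDerivAt : ∀ᵐ t, HasDerivAt γ.toFun (γ.deriv' t) t := by
  filter_upwards [LocallyIntegrable.ae_hasDerivAt_integral γ.locallyIntegrable_deriv] with t ht
  exact ((ht 0).const_add (γ.toFun 0)).congr_of_eventuallyEq
    (Eventually.of_forall γ.eq_integral)

lemma isUnitDensity (hreg : γ.IsRegular) (hL : 0 < γ.length) :
    IsUnitDensity fun t => ‖γ.deriv' t‖ / γ.length where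
  nonneg t := by positivity
  per t := by simp only [γ.deriv'_periodic t]
  pos := by
    filter_upwards [hreg] with t ht
    exact div_pos (norm_pos_iff.2 ht) hL
  int := locallyIntegrable_of_periodic (fun t => by simp only [γ.deriv'_periodic t])
    (γ.integrableOn.norm.div_const _)
  mass := by rw [intervalIntegral.integral_div, ← length, div_self hL.ne']

variable (hreg : γ.IsRegular) (hL : 0 < γ.length)

/-- The curve parametrized by arc length, scaled to length one. -/
def unitLoop (x : ℝ) : EuclideanSpace ℝ (Fin n) :=
  γ.length⁻¹ • γ.toFun ((γ.isUnitDensity hreg hL).reparam.symm x)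

lemma unitLoop_reparam (t : ℝ) :
    γ.unitLoop hreg hL ((γ.isUnitDensity hreg hL).reparam t) = γ.length⁻¹ • γ.toFun t := by
  rw [unitLoop, OrderIso.symm_apply_apply]

lemma range_unitLoop :
    range (γ.unitLoop hreg hL) = (fun x => γ.length⁻¹ • x) '' range γ.toFun := by
  rw [← range_comp, ← (γ.isUnitDensity hreg hL).reparam.surjective.range_comp]
  exact congrArg range (funext fun t => γ.unitLoop_reparam hreg hL t)

lemma norm_unitLoop_sub_le {x y : ℝ} (hxy : x ≤ y) :
    ‖γ.unitLoop hreg hL y - γ.unitLoop hreg hL x‖ ≤ y - x := by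
  have hd := γ.isUnitDensity hreg hL
  obtain ⟨a, rfl⟩ := hd.reparam.surjective x
  obtain ⟨b, rfl⟩ := hd.reparam.surjective y
  have hab : a ≤ b := hd.reparam.le_iff_le.1 hxy
  rw [unitLoop_reparam, unitLoop_reparam, ← smul_sub, norm_smul, hd.reparam_apply,
    hd.reparam_apply, hd.primitive_sub, intervalIntegral.integral_div, γ.sub_eq_integral,
    norm_inv, Real.norm_of_nonneg hL.le, inv_mul_eq_div]
  gcongr
  exact norm_integral_le_integral_norm hab

lemma ae_hasDerivAt_unitLoop : ∀ᵐ t, HasDerivAt (γ.unitLoop hreg hL)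
    (‖γ.deriv' t‖⁻¹ • γ.deriv' t) ((γ.isUnitDensity hreg hL).reparam t) := by
  have hd := γ.isUnitDensity hreg hL
  filter_upwards [hd.ae_hasDerivAt_reparam, hd.pos, γ.ae_hasDerivAt] with t h1 h2 h3
  have h4 : HasDerivAt hd.reparam.symm (‖γ.deriv' t‖ / γ.length)⁻¹ (hd.reparam t) := by
    refine HasDerivAt.of_local_left_inverse hd.reparam.symm.continuous.continuousAt ?_ h2.ne'
      (Eventually.of_forall hd.reparam.apply_symm_apply)
    rwa [OrderIso.symm_apply_apply]
  have h5 : HasDerivAt γ.toFun (γ.deriv' t) (hd.reparam.symm (hd.reparam t)) := by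
    rwa [OrderIso.symm_apply_apply]
  refine ((h5.scomp (hd.reparam t) h4).const_smul γ.length⁻¹).congr_deriv ?_
  rw [smul_smul]
  congr 1
  field_simp

lemma isUnitLoop_unitLoop (hinj : γ.IsInj) : IsUnitLoop (γ.unitLoop hreg hL) where
  lip := by
    refine LipschitzWith.of_dist_le_mul fun x y => ?_
    rw [NNReal.coe_one, one_mul]
    rcases le_total x y with h | h
    · rw [dist_comm, dist_comm x, dist_eq_norm, Real.dist_eq, abs_of_nonneg (sub_nonneg.2 h)]
      exact γ.norm_unitLoop_sub_le hreg hL h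
    · rw [dist_eq_norm, Real.dist_eq, abs_of_nonneg (sub_nonneg.2 h)]
      exact γ.norm_unitLoop_sub_le hreg hL h
  per x := by
    rw [unitLoop, unitLoop, IsUnitDensity.reparam_symm_add_one, γ.periodic]
  inj x y h := by
    obtain ⟨k, hk⟩ := hinj _ _ (smul_right_injective _ (inv_ne_zero hL.ne') h)
    refine ⟨k, ?_⟩
    have h1 := (γ.isUnitDensity hreg hL).reparam_add_int
      ((γ.isUnitDensity hreg hL).reparam.symm y) k
    rw [← hk, add_sub_cancel, OrderIso.apply_symm_apply, OrderIso.apply_symm_apply] at h1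
    rw [h1, add_sub_cancel_left, hk]
  speed := by
    refine (γ.isUnitDensity hreg hL).ae_of_ae_comp_reparam
      (measurableSet_eq_fun (measurable_deriv _).norm measurable_const) ?_
    filter_upwards [γ.ae_hasDerivAt_unitLoop hreg hL, hreg] with t ht h0
    rw [ht.deriv, norm_smul, norm_inv, norm_norm, inv_mul_cancel₀ (norm_ne_zero_iff.2 h0)]

end ClosedCurve

end ArclengthReparametrization

section EnergyReparametrization

open Filter Topology InnerProductGeometry

/-- The scale invariant energy density of a curve at a pair of parameters. -/
def pairDensity {E : Type*} [NormedAddCommGroup E] [InnerProductSpace ℝ E] (γ : ℝ → E)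
    (q s x y : ℝ) : ℝ≥0∞ :=
  ENNReal.ofReal (Real.sin (angle (deriv γ x) (γ y - γ x)) ^ q * (π * ‖γ y - γ x‖) ^ (-s))

lemma pairDensity_add_right {E : Type*} [NormedAddCommGroup E] [InnerProductSpace ℝ E] (γ : ℝ → E)
    (q s x w : ℝ) : pairDensity γ q s x (x + w) =
      ENNReal.ofReal (sinL γ x w ^ q * (π * chord γ x w) ^ (-s)) := rfl

lemma periodic_pairDensity {E : Type*} [NormedAddCommGroup E] [InnerProductSpace ℝ E] {γ : ℝ → E}
    (hγ : Function.Periodic γ 1) (q s x : ℝ) : Function.Periodic (pairDensity γ q s x) 1 :=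
  fun y => by rw [pairDensity, pairDensity, hγ y]

lemma measurable_pairDensity {E : Type*} [NormedAddCommGroup E] [InnerProductSpace ℝ E]
    [FiniteDimensional ℝ E] [MeasurableSpace E] [BorelSpace E] {γ : ℝ → E} (hc : Continuous γ)
    (q s : ℝ) {α : Type*} [MeasurableSpace α] {f g : α → ℝ} (hf : Measurable f)
    (hg : Measurable g) : Measurable fun a => pairDensity γ q s (f a) (g a) := by
  have h1 : Measurable fun a => γ (g a) - γ (f a) :=
    (hc.measurable.comp hg).sub (hc.measurable.comp hf)
  have h2 := Real.measurable_sin.comp (measurable_angle ((measurable_deriv γ).comp hf) h1)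
  exact ((h2.pow_const q).mul ((h1.norm.const_mul π).pow_const (-s))).ennreal_ofReal

lemma IsUnitLoop.lintegral_unitSquare_eq {E : Type*} [NormedAddCommGroup E]
    [InnerProductSpace ℝ E] [FiniteDimensional ℝ E] [MeasurableSpace E] [BorelSpace E] {γ : ℝ → E}
    (hγ : IsUnitLoop γ) (q s : ℝ) :
    ∫⁻ z, ENNReal.ofReal (sinL γ z.1 z.2 ^ q * (π * chord γ z.1 z.2) ^ (-s)) ∂unitSquare =
      ∫⁻ x in Ioc (0:ℝ) 1, ∫⁻ y in Ioc (0:ℝ) 1, pairDensity γ q s x y := by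
  have hm : Measurable fun z : ℝ × ℝ => pairDensity γ q s z.1 (z.1 + z.2) :=
    measurable_pairDensity hγ.lip.continuous q s measurable_fst (measurable_fst.add measurable_snd)
  simp only [← pairDensity_add_right]
  rw [unitSquare, lintegral_prod _ hm.aemeasurable]
  refine lintegral_congr fun x => ?_
  rw [← setLIntegral_add_right_of_periodic (periodic_pairDensity hγ.per q s x) x]
  exact lintegral_congr fun w => by rw [add_comm]

namespace ClosedCurve

variable {n : ℕ} (γ : ClosedCurve n) (hreg : γ.IsRegular) (hL : 0 < γ.length)

lemma energy_density_eq {p q : ℝ} (hq : 0 < q) (hs : 0 < p - q) {u : ℝ} (hu : γ.deriv' u ≠ 0)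
    (hd : HasDerivAt (γ.unitLoop hreg hL) (‖γ.deriv' u‖⁻¹ • γ.deriv' u)
      ((γ.isUnitDensity hreg hL).reparam u)) (v : ℝ) :
    ENNReal.ofReal (‖projPerp (γ.deriv' u) (γ.toFun v - γ.toFun u)‖ ^ q /
        ‖γ.toFun v - γ.toFun u‖ ^ p * (‖γ.deriv' u‖ * ‖γ.deriv' v‖)) =
      ENNReal.ofReal (γ.length ^ (q + 2 - p) * π ^ (p - q)) *
        (ENNReal.ofReal (‖γ.deriv' u‖ / γ.length) *
          (ENNReal.ofReal (‖γ.deriv' v‖ / γ.length) *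
            pairDensity (γ.unitLoop hreg hL) q (p - q) ((γ.isUnitDensity hreg hL).reparam u)
              ((γ.isUnitDensity hreg hL).reparam v))) := by
  have hu' : 0 < ‖γ.deriv' u‖ := norm_pos_iff.2 hu
  rw [pairDensity, ← ENNReal.ofReal_mul (by positivity), ← ENNReal.ofReal_mul (by positivity),
    ← ENNReal.ofReal_mul (by positivity), hd.deriv, unitLoop_reparam, unitLoop_reparam, ← smul_sub,
    angle_smul_left_of_pos _ _ (inv_pos.2 hu'), angle_smul_right_of_pos _ _ (inv_pos.2 hL),
    norm_projPerp hu, norm_smul, norm_inv, Real.norm_of_nonneg hL.le]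
  congr 1
  set S := Real.sin (angle (γ.deriv' u) (γ.toFun v - γ.toFun u))
  have hS : 0 ≤ S := sin_angle_nonneg _ _
  set r := ‖γ.toFun v - γ.toFun u‖
  have hr : 0 ≤ r := norm_nonneg _
  rcases hr.eq_or_lt with h0 | h0
  · rw [← h0]
    simp [Real.zero_rpow hq.ne', Real.zero_rpow (neg_ne_zero.2 hs.ne'), -neg_sub]
  · rw [Real.mul_rpow hS hr, Real.mul_rpow pi_pos.le (by positivity),
      Real.mul_rpow (by positivity) hr, Real.inv_rpow hL.le, ← Real.rpow_neg hL.le, neg_neg,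
      Real.rpow_neg pi_pos.le, show q + 2 - p = 2 - (p - q) by ring, Real.rpow_sub hL,
      Real.rpow_two, mul_div_assoc, ← Real.rpow_sub h0, neg_sub]
    have hLp : γ.length ^ (p - q) ≠ 0 := by positivity
    have hpp : π ^ (p - q) ≠ 0 := by positivity
    field_simp

lemma TP_eq_unitLoop {p q : ℝ} (hq : 0 < q) (hs : 0 < p - q) (hinj : γ.IsInj) :
    TP p q γ = ENNReal.ofReal (γ.length ^ (q + 2 - p) * π ^ (p - q)) *
      ∫⁻ z, ENNReal.ofReal (sinL (γ.unitLoop hreg hL) z.1 z.2 ^ q *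
        (π * chord (γ.unitLoop hreg hL) z.1 z.2) ^ (-(p - q))) ∂unitSquare := by
  have hU := γ.isUnitLoop_unitLoop hreg hL hinj
  have hd := γ.isUnitDensity hreg hL
  have hm : Measurable fun z : ℝ × ℝ => pairDensity (γ.unitLoop hreg hL) q (p - q) z.1 z.2 :=
    measurable_pairDensity hU.lip.continuous q (p - q) measurable_fst measurable_snd
  rw [hU.lintegral_unitSquare_eq, ← hd.setLIntegral_comp_reparam hm.lintegral_prod_right',
    ← lintegral_const_mul' _ _ ENNReal.ofReal_ne_top, TP]
  refine lintegral_congr_ae (ae_restrict_of_ae ?_)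
  filter_upwards [hreg, γ.ae_hasDerivAt_unitLoop hreg hL] with u hu h1
  simp only [γ.energy_density_eq hreg hL hq hs hu h1]
  rw [lintegral_const_mul' _ _ ENNReal.ofReal_ne_top,
    lintegral_const_mul' _ _ ENNReal.ofReal_ne_top]
  congr 2
  have hper : Function.Periodic (fun v => ENNReal.ofReal (‖γ.deriv' v‖ / γ.length) *
      pairDensity (γ.unitLoop hreg hL) q (p - q) (hd.reparam u) (hd.reparam v)) 1 := fun v => by
    simp only [γ.deriv'_periodic v, hd.reparam_add_one,
      periodic_pairDensity hU.per q (p - q) (hd.reparam u) (hd.reparam v)]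
  have hmu : Measurable (pairDensity (γ.unitLoop hreg hL) q (p - q) (hd.reparam u)) :=
    measurable_pairDensity hU.lip.continuous q (p - q) measurable_const measurable_id
  rw [← hd.setLIntegral_comp_reparam hmu,
    ← setLIntegral_add_right_of_periodic hper u]
  exact lintegral_congr fun w => by rw [add_comm]

end ClosedCurve

lemma IsCircle.of_smul {F : Type*} [NormedAddCommGroup F] [InnerProductSpace ℝ F] {S : Set F}
    {a : ℝ} (ha : 0 < a) (h : IsCircle ((fun x => a • x) '' S)) : IsCircle S := by
  obtain ⟨c, r, V, hr, hV, hS⟩ := h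
  refine ⟨a⁻¹ • c, a⁻¹ * r, V, by positivity, hV, ?_⟩
  ext x
  have h1 : x ∈ S ↔ a • x ∈ (fun x => a • x) '' S :=
    (smul_right_injective F ha.ne').mem_set_image.symm
  have h2 : x - a⁻¹ • c = a⁻¹ • (a • x - c) := by
    rw [smul_sub, inv_smul_smul₀ ha.ne']
  rw [h1, hS, mem_ofPred_eq, mem_ofPred_eq, h2, norm_smul, norm_inv, Real.norm_of_nonneg ha.le,
    V.smul_mem_iff (inv_ne_zero ha.ne'), mul_right_inj' (inv_ne_zero ha.ne')]

end EnergyReparametrization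

/-- **Uniqueness of minimizers** (Theorem 1.2 (ii)): for `q > 1` and
`p ∈ [q+1, 2q+1) ∩ [2q−2, 4q−2]` or `p = q+1`, a curve of length `L` attaining the sharp
lower bound for `TP^{(p,q)}` has a round circle as image. -/
theorem tp_uniqueness {n : ℕ} (p q L : ℝ) (hq : 1 < q)
    (hp : (q + 1 ≤ p ∧ p < 2 * q + 1 ∧ 2 * q - 2 ≤ p ∧ p ≤ 4 * q - 2) ∨ p = q + 1)
    (hL : 0 < L) (γ : ClosedCurve n) (hinj : γ.IsInj) (hreg : γ.IsRegular)
    (hlen : γ.length = L)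
    (heq : TP p q γ = ENNReal.ofReal (L ^ (q + 2 - p) * π ^ (p - q) * ∫ w in (0:ℝ)..1, Real.sin (π * w) ^ (2 * q - p))) :
    IsCircle (Set.range γ.toFun) := by
  subst hlen
  have hs1 : 1 ≤ p - q := by rcases hp with hp | hp <;> linarith
  have hs3 : p - q ≤ 3 * q - 2 := by rcases hp with hp | hp <;> linarith
  have hs : p - q = 1 ∨ q - (p - q) ≤ 2 := hp.symm.imp (fun h => by linarith) fun h => by linarith
  have hC : 0 < γ.length ^ (q + 2 - p) * π ^ (p - q) := by positivity
  rw [γ.TP_eq_unitLoop hreg hL (by linarith) (by linarith) hinj, ENNReal.ofReal_mul hC.le] at heq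
  have hE := (ENNReal.mul_right_inj (ENNReal.ofReal_pos.2 hC).ne' ENNReal.ofReal_ne_top).1 heq
  rw [integral_of_le zero_le_one, show 2 * q - p = q - (p - q) by ring] at hE
  have hcirc := (γ.isUnitLoop_unitLoop hreg hL hinj).isCircle_of_energy_eq hq hs1 hs3 hs hE
  rw [γ.range_unitLoop] at hcirc
  exact hcirc.of_smul (inv_pos.2 hL)

end
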